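/- Let h = (h₁,…,h_s) and g = (g₁,…,g_t) be tuples of real polynomials in n variables. Assume Ideal[h] + Qmod[g] is archimedean, i.e., there exists ρ ∈ Ideal[h] + Qmod[g] such that {x ∈ ℝⁿ : ρ(x) ≥ 0} is compact. If the set {x ∈ ℝⁿ : h₁(x) = ⋯ = h_s(x) = 0, g₁(x) ≥ 0, …, g_t(x) ≥ 0} is empty, then the constant polynomial −1 belongs to Ideal[h] + Qmod[g]. -/

import Mathlib

universe u

section CutComparison

open Polynomial

/-- The intermediate value property for polynomials over an ordered field, which characterises
real closed fields. -/
def PolynomialIVT (K : Type*) [Field K] [LinearOrder K] : Prop :=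
  ∀ (P : K[X]) (a b : K), a < b → P.eval a * P.eval b < 0 → ∃ c, a < c ∧ c < b ∧ P.eval c = 0

section OneField

variable {K : Type*} [Field K] [LinearOrder K] [IsStrictOrderedRing K]

theorem PolynomialIVT.eval_mul_eval_pos (hK : PolynomialIVT K) (P : K[X]) {a b : K} (hab : a ≤ b)
    (hP : ∀ x, a ≤ x → x ≤ b → P.eval x ≠ 0) : 0 < P.eval a * P.eval b := by
  rcases hab.eq_or_lt with rfl | hab
  · exact mul_self_pos.2 (hP a le_rfl le_rfl)
  · by_contra hneg
    have hne : P.eval a * P.eval b ≠ 0 :=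
      mul_ne_zero (hP a le_rfl hab.le) (hP b hab.le le_rfl)
    obtain ⟨c, hac, hcb, hc⟩ := hK P a b hab (lt_of_le_of_ne (not_lt.1 hneg) hne)
    exact hP c hac.le hcb.le hc

theorem PolynomialIVT.eval_pos_iff (hK : PolynomialIVT K) (P : K[X]) (hP : ∀ x, P.eval x ≠ 0)
    (a b : K) : 0 < P.eval a ↔ 0 < P.eval b := by
  have key : 0 < P.eval a * P.eval b := by
    rcases le_total a b with hab | hab
    · exact hK.eval_mul_eval_pos P hab fun x _ _ => hP x
    · rw [mul_comm]
      exact hK.eval_mul_eval_pos P hab fun x _ _ => hP x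
  constructor
  · intro h
    exact (pos_iff_pos_of_mul_pos key).1 h
  · intro h
    exact (pos_iff_pos_of_mul_pos key).2 h

/-- Rolle's theorem for polynomials. -/
theorem PolynomialIVT.exists_derivative_eq_zero (hK : PolynomialIVT K) {P : K[X]} (hP0 : P ≠ 0)
    {a b : K} (hab : a < b) (ha : P.eval a = 0) (hb : P.eval b = 0) :
    ∃ c, a ≤ c ∧ c ≤ b ∧ P.derivative.eval c = 0 := by
  by_contra! hno
  obtain ⟨r, hr, hmin⟩ := Finset.exists_min_image (P.roots.toFinset.filter (a < ·)) id
    ⟨b, by simp [hP0, hab, hb]⟩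
  simp only [Finset.mem_filter, Multiset.mem_toFinset, mem_roots', IsRoot.def, id] at hr hmin
  obtain ⟨⟨-, hr⟩, har⟩ := hr
  have hrb : r ≤ b := hmin b ⟨⟨hP0, hb⟩, hab⟩
  obtain ⟨P₁, rfl⟩ := dvd_iff_isRoot.2 ha
  have hr' : P₁.eval r = 0 := by
    simpa [sub_ne_zero.2 har.ne'] using hr
  obtain ⟨Q, rfl⟩ := dvd_iff_isRoot.2 hr'
  have hda : ((X - C a) * ((X - C r) * Q)).derivative.eval a = (a - r) * Q.eval a := by
    simp [derivative_mul]
  have hdr : ((X - C a) * ((X - C r) * Q)).derivative.eval r = (r - a) * Q.eval r := by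
    simp [derivative_mul]
  have hQ : 0 < Q.eval a * Q.eval r := by
    refine hK.eval_mul_eval_pos Q har.le fun x hax hxr hx => ?_
    rcases hax.eq_or_lt with rfl | hax
    · exact hno a le_rfl hab.le (by rw [hda, hx, mul_zero])
    · have : r ≤ x := hmin x ⟨⟨hP0, by simp [hx]⟩, hax⟩
      obtain rfl : x = r := le_antisymm hxr this
      exact hno x har.le hrb (by rw [hdr, hx, mul_zero])
  obtain ⟨c, hac, hcr, hc⟩ := hK (derivative ((X - C a) * ((X - C r) * Q))) a r har (by
    rw [hda, hdr]
    have h1 : 0 < (r - a) * (r - a) := mul_self_pos.2 (sub_ne_zero.2 har.ne')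
    nlinarith [mul_pos h1 hQ])
  exact hno c hac.le (hcr.le.trans hrb) hc

/-- A root of a monic polynomial is bounded by an expression in the coefficients. -/
theorem abs_le_of_monic_of_eval₂_eq_zero {E : Type*} [Field E] (i : E →+* K) {P : E[X]}
    (hP : P.Monic) {x : K} (hx : P.eval₂ i x = 0) :
    |x| ≤ 1 + ∑ k ∈ Finset.range P.natDegree, |i (P.coeff k)| := by
  by_contra! hlt
  have hS : 0 ≤ ∑ k ∈ Finset.range P.natDegree, |i (P.coeff k)| :=
    Finset.sum_nonneg fun _ _ => abs_nonneg _
  have hx1 : 1 < |x| := by linarith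
  rw [eval₂_eq_sum_range, Finset.sum_range_succ, hP.coeff_natDegree, map_one, one_mul] at hx
  rcases hd : P.natDegree with _ | d
  · rw [hd] at hx
    simp at hx
  rw [hd] at hx hlt hS
  have h1 : |x| ^ (d + 1) = |∑ k ∈ Finset.range (d + 1), i (P.coeff k) * x ^ k| := by
    rw [← abs_pow, ← abs_neg]
    congr 1
    linear_combination -hx
  have h2 : |∑ k ∈ Finset.range (d + 1), i (P.coeff k) * x ^ k| ≤
      (∑ k ∈ Finset.range (d + 1), |i (P.coeff k)|) * |x| ^ d := by
    rw [Finset.sum_mul]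
    refine (Finset.abs_sum_le_sum_abs _ _).trans (Finset.sum_le_sum fun k hk => ?_)
    rw [abs_mul, abs_pow]
    exact mul_le_mul_of_nonneg_left
      (pow_le_pow_right₀ hx1.le (Nat.lt_succ_iff.1 (Finset.mem_range.1 hk))) (abs_nonneg _)
  rw [← h1, pow_succ'] at h2
  have := le_of_mul_le_mul_right h2 (pow_pos (by linarith) d)
  linarith

end OneField

/-- Finitely many conditions that each hold close to a cut hold simultaneously close to it. -/
theorem exists_finset_cut {E K₁ : Type*} [Field E] [Field K₁] [LinearOrder K₁] {ι : Type*}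
    (i₁ : E →+* K₁) {α : K₁} (good : E → E → ι → Prop)
    (hmono : ∀ a c c' d d', i₁ c ≤ i₁ c' → i₁ d' ≤ i₁ d → good c d a → good c' d' a)
    (hne : ∃ c d, i₁ c < α ∧ α < i₁ d) (s : Finset ι)
    (hs : ∀ a ∈ s, ∃ c d, i₁ c < α ∧ α < i₁ d ∧ good c d a) :
    ∃ c d, i₁ c < α ∧ α < i₁ d ∧ ∀ a ∈ s, good c d a := by
  classical
  induction s using Finset.induction_on with
  | empty => simpa using hne
  | insert a s _ ih =>
    obtain ⟨c, d, hc, hd, hcd⟩ := ih fun b hb => hs b (Finset.mem_insert_of_mem hb)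
    obtain ⟨c', d', hc', hd', hcd'⟩ := hs a (Finset.mem_insert_self a s)
    obtain ⟨u, hu, huc, huc'⟩ : ∃ u, i₁ u < α ∧ i₁ c ≤ i₁ u ∧ i₁ c' ≤ i₁ u := by
      rcases le_total (i₁ c) (i₁ c') with h | h
      exacts [⟨c', hc', h, le_rfl⟩, ⟨c, hc, le_rfl, h⟩]
    obtain ⟨v, hv, hvd, hvd'⟩ : ∃ v, α < i₁ v ∧ i₁ v ≤ i₁ d ∧ i₁ v ≤ i₁ d' := by
      rcases le_total (i₁ d) (i₁ d') with h | h
      exacts [⟨d, hd, le_rfl, h⟩, ⟨d', hd', h, le_rfl⟩]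
    refine ⟨u, v, hu, hv, fun b hb => ?_⟩
    rcases Finset.mem_insert.1 hb with rfl | hb
    · exact hmono _ _ _ _ _ huc' hvd' hcd'
    · exact hmono _ _ _ _ _ huc hvd (hcd b hb)

section TwoFields

variable {E K₁ K₂ : Type*} [Field E] [Field K₁] [LinearOrder K₁] [IsStrictOrderedRing K₁]
  [Field K₂] [LinearOrder K₂] [IsStrictOrderedRing K₂]

theorem map_lt_map_iff_of_pos_iff {R : Type*} [Ring R] {i₁ : R →+* K₁} {i₂ : R →+* K₂}
    (hi : ∀ e, 0 < i₁ e ↔ 0 < i₂ e) (a b : R) : i₁ a < i₁ b ↔ i₂ a < i₂ b := by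
  rw [← sub_pos, ← map_sub, hi, map_sub, sub_pos]

/-- Two elements defining the same cut in a common subfield give the same signs to those
polynomials over the subfield whose roots, and the roots of whose factors, lie in the subfield. -/
theorem eval₂_pos_iff_of_same_cut (h₁ : PolynomialIVT K₁) (h₂ : PolynomialIVT K₂)
    (i₁ : E →+* K₁) (i₂ : E →+* K₂) (hi : ∀ e, 0 < i₁ e ↔ 0 < i₂ e) {α : K₁} {β : K₂}
    (hl : ∀ e, i₁ e < α → i₂ e < β) (hr : ∀ e, α < i₁ e → β < i₂ e) (hα : α ∉ i₁.range)
    (d : ℕ)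
    (H₁ : ∀ Q : E[X], Q ≠ 0 → Q.natDegree ≤ d → ∀ x, Q.eval₂ i₁ x = 0 → x ∈ i₁.range)
    (H₂ : ∀ Q : E[X], Q ≠ 0 → Q.natDegree ≤ d → ∀ x, Q.eval₂ i₂ x = 0 → x ∈ i₂.range)
    (Q : E[X]) (hQ : Q.natDegree ≤ d) : 0 < Q.eval₂ i₁ α ↔ 0 < Q.eval₂ i₂ β := by
  induction d generalizing Q with
  | zero =>
    rw [eq_C_of_natDegree_eq_zero (Nat.le_zero.1 hQ)]
    simpa using hi _
  | succ d ih =>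
    by_cases hQ0 : Q = 0
    · simp [hQ0]
    by_cases hroot : ∃ e, Q.eval e = 0
    · obtain ⟨e, he⟩ := hroot
      obtain ⟨T, rfl⟩ := dvd_iff_isRoot.2 he
      have hT : T.natDegree ≤ d := by
        have hT0 : T ≠ 0 := right_ne_zero_of_mul hQ0
        rw [natDegree_mul (X_sub_C_ne_zero e) hT0, natDegree_X_sub_C] at hQ
        omega
      have key := ih (fun Q h h' => H₁ Q h (by omega)) (fun Q h h' => H₂ Q h (by omega)) T hT
      have hneg := ih (fun Q h h' => H₁ Q h (by omega)) (fun Q h h' => H₂ Q h (by omega)) (-T)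
        (by rwa [natDegree_neg])
      simp only [eval₂_neg, Left.neg_pos_iff] at hneg
      simp only [eval₂_mul, eval₂_sub, eval₂_X, eval₂_C]
      rcases lt_trichotomy (i₁ e) α with h | h | h
      · rw [mul_pos_iff_of_pos_left (sub_pos.2 h), mul_pos_iff_of_pos_left (sub_pos.2 (hl e h)),
          key]
      · exact absurd ⟨e, h⟩ hα
      · rw [← neg_mul_neg, mul_pos_iff_of_pos_left (by linarith), Left.neg_pos_iff, hneg,
          ← neg_mul_neg (β - i₂ e), mul_pos_iff_of_pos_left (by linarith [hr e h]),
          Left.neg_pos_iff]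
    · have n₁ : ∀ x, (Q.map i₁).eval x ≠ 0 := fun x hx => by
        rw [eval_map] at hx
        obtain ⟨e, rfl⟩ := H₁ Q hQ0 hQ x hx
        rw [eval₂_hom, map_eq_zero] at hx
        exact hroot ⟨e, hx⟩
      have n₂ : ∀ x, (Q.map i₂).eval x ≠ 0 := fun x hx => by
        rw [eval_map] at hx
        obtain ⟨e, rfl⟩ := H₂ Q hQ0 hQ x hx
        rw [eval₂_hom, map_eq_zero] at hx
        exact hroot ⟨e, hx⟩
      rw [← eval_map, ← eval_map, h₁.eval_pos_iff _ n₁ α (i₁ 0), h₂.eval_pos_iff _ n₂ β (i₂ 0),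
        eval_map, eval_map, eval₂_hom, eval₂_hom, hi]

theorem exists_root_same_cut (h₁ : PolynomialIVT K₁) (h₂ : PolynomialIVT K₂)
    (i₁ : E →+* K₁) (i₂ : E →+* K₂) (hi : ∀ e, 0 < i₁ e ↔ 0 < i₂ e) {P : E[X]} (hP : P.Monic)
    (H₁ : ∀ Q : E[X], Q ≠ 0 → Q.natDegree < P.natDegree →
      ∀ x, Q.eval₂ i₁ x = 0 → x ∈ i₁.range)
    {α : K₁} (hα : α ∉ i₁.range) (hPα : P.eval₂ i₁ α = 0) :
    ∃ β, P.eval₂ i₂ β = 0 ∧ (∀ e, i₁ e < α → i₂ e < β) ∧ (∀ e, α < i₁ e → β < i₂ e) := by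
  classical
  have hchar : CharZero E := (RingHom.charZero_iff i₁.injective).2 inferInstance
  have hlt := map_lt_map_iff_of_pos_iff hi
  have hdeg : P.natDegree ≠ 0 := fun h => by
    rw [eq_C_of_natDegree_eq_zero h, ← h, hP.coeff_natDegree] at hPα
    simp at hPα
  have hP₁ : P.map i₁ ≠ 0 := (hP.map i₁).ne_zero
  have hP₂ : P.map i₂ ≠ 0 := (hP.map i₂).ne_zero
  have hroot : ∀ e, P.eval e ≠ 0 := fun e he => by
    obtain ⟨T, rfl⟩ := dvd_iff_isRoot.2 he
    have hT0 : T ≠ 0 := right_ne_zero_of_mul hP.ne_zero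
    refine hα (H₁ T hT0 ?_ α ?_)
    · rw [natDegree_mul (X_sub_C_ne_zero e) hT0, natDegree_X_sub_C]
      omega
    · simp only [eval₂_mul, eval₂_sub, eval₂_X, eval₂_C, mul_eq_zero] at hPα
      exact hPα.resolve_left fun h => hα ⟨e, (sub_eq_zero.1 h).symm⟩
  have hd0 : derivative P ≠ 0 := fun h => hdeg (derivative_eq_zero.1 h)
  have hdP : ∀ x, (derivative P).eval₂ i₁ x = 0 → x ∈ i₁.range :=
    H₁ _ hd0 (natDegree_derivative_lt hdeg)
  have hne : ∃ c d, i₁ c < α ∧ α < i₁ d := by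
    have habs := abs_le_of_monic_of_eval₂_eq_zero i₁ hP hPα
    have hb : ∀ k, |i₁ (P.coeff k)| ≤ i₁ (P.coeff k ^ 2 + 1) := fun k => by
      rw [map_add, map_pow, map_one, ← sq_abs]
      nlinarith [sq_nonneg (|i₁ (P.coeff k)| - 1), abs_nonneg (i₁ (P.coeff k))]
    have hB : |α| < i₁ (2 + ∑ k ∈ Finset.range P.natDegree, (P.coeff k ^ 2 + 1)) := by
      rw [map_add, map_sum, map_ofNat]
      have := Finset.sum_le_sum fun k (_ : k ∈ Finset.range P.natDegree) => hb k
      linarith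
    have hneg := (abs_lt.1 hB).1
    rw [← map_neg] at hneg
    exact ⟨_, _, hneg, (abs_lt.1 hB).2⟩
  have hne' := hne
  obtain ⟨c₀, d₀, hc₀, hd₀⟩ := hne'
  by_contra! hno
  obtain ⟨c, d, hc, hd, hcd⟩ := exists_finset_cut i₁ (α := α)
    (fun c d x => ¬ (i₁ c < x ∧ x < i₁ d))
    (fun a c c' d d' h h' hg hh => hg ⟨h.trans_lt hh.1, hh.2.trans_le h'⟩) hne
    ((derivative P).map i₁).roots.toFinset (fun x hx => by
      simp only [Multiset.mem_toFinset, mem_roots', IsRoot.def, eval_map] at hx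
      obtain ⟨e, rfl⟩ := hdP x hx.2
      rcases lt_trichotomy (i₁ e) α with h | h | h
      · exact ⟨e, d₀, h, hd₀, fun hh => lt_irrefl _ hh.1⟩
      · exact absurd ⟨e, h⟩ hα
      · exact ⟨c₀, e, hc₀, h, fun hh => lt_irrefl _ hh.2⟩)
  obtain ⟨c', d', hc', hd', hcd'⟩ := exists_finset_cut i₁ (α := α)
    (fun c d x => ¬ (i₂ c < x ∧ x < i₂ d))
    (fun a c c' d d' h h' hg hh => hg
      ⟨(not_lt.1 fun h2 => not_lt.2 h ((hlt _ _).2 h2) : i₂ c ≤ i₂ c').trans_lt hh.1,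
        hh.2.trans_le (not_lt.1 fun h2 => not_lt.2 h' ((hlt _ _).2 h2))⟩) hne
    (P.map i₂).roots.toFinset (fun x hx => by
      simp only [Multiset.mem_toFinset, mem_roots', IsRoot.def, eval_map] at hx
      by_cases hx' : ∀ e, i₁ e < α → i₂ e < x
      · obtain ⟨e, he, hxe⟩ := hno x hx.2 hx'
        exact ⟨c₀, e, hc₀, he, fun hh => absurd hh.2 (not_lt.2 hxe)⟩
      · push Not at hx'
        obtain ⟨e, he, hxe⟩ := hx'
        exact ⟨e, d₀, he, hd₀, fun hh => absurd hh.1 (not_lt.2 hxe)⟩)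
  obtain ⟨u, v, hu, hv, huv⟩ := exists_finset_cut i₁ (α := α)
    (fun u v (p : E × E) => i₁ p.1 ≤ i₁ u ∧ i₁ v ≤ i₁ p.2)
    (fun a c c' d d' h h' hg => ⟨hg.1.trans h, h'.trans hg.2⟩) hne {(c, d), (c', d')} (by
      intro a ha
      simp only [Finset.mem_insert, Finset.mem_singleton] at ha
      rcases ha with rfl | rfl
      exacts [⟨c, d, hc, hd, le_rfl, le_rfl⟩, ⟨c', d', hc', hd', le_rfl, le_rfl⟩])
  have hcu := huv (c, d) (by simp)
  have hcu' := huv (c', d') (by simp)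
  have hdno : ∀ x, i₁ u < x → x < i₁ v → (derivative P).eval₂ i₁ x ≠ 0 := fun x hx hx' h0 =>
    hcd x (by
      simp only [Multiset.mem_toFinset, mem_roots', IsRoot.def, eval_map]
      exact ⟨(Polynomial.map_ne_zero_iff i₁.injective).2 hd0, h0⟩)
      ⟨hcu.1.trans_lt hx, hx'.trans_le hcu.2⟩
  have hPα' : (P.map i₁).eval α = 0 := by rwa [eval_map]
  have honly : ∀ x, i₁ u < x → x < i₁ v → P.eval₂ i₁ x = 0 → x = α := fun x hx hx' h0 => by
    rw [← eval_map] at h0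
    rcases lt_trichotomy x α with h | h | h
    · obtain ⟨y, hy, hy', hy0⟩ := h₁.exists_derivative_eq_zero hP₁ h h0 hPα'
      rw [derivative_map, eval_map] at hy0
      exact absurd hy0 (hdno y (hx.trans_le hy) (hy'.trans_lt hv))
    · exact h
    · obtain ⟨y, hy, hy', hy0⟩ := h₁.exists_derivative_eq_zero hP₁ h hPα' h0
      rw [derivative_map, eval_map] at hy0
      exact absurd hy0 (hdno y (hu.trans_le hy) (hy'.trans_lt hx'))
  obtain ⟨Q, hQ⟩ := dvd_iff_isRoot.2 hPα'
  have hQpos : 0 < Q.eval (i₁ u) * Q.eval (i₁ v) := by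
    refine h₁.eval_mul_eval_pos Q (hu.trans hv).le fun x hux hxv hx => ?_
    have hPx : P.eval₂ i₁ x = 0 := by rw [← eval_map, hQ, eval_mul, hx, mul_zero]
    have hxr : x ∉ i₁.range := by
      rintro ⟨e, rfl⟩
      rw [eval₂_hom, map_eq_zero] at hPx
      exact hroot e hPx
    obtain rfl : x = α := honly x (lt_of_le_of_ne hux fun h => hxr ⟨u, h⟩)
      (lt_of_le_of_ne hxv fun h => hxr ⟨v, h.symm⟩) hPx
    refine hdno x hu hv ?_
    rw [← eval_map, ← derivative_map, hQ]
    simp [derivative_mul, hx]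
  have hneg : i₁ (P.eval u * P.eval v) < i₁ 0 := by
    rw [map_mul, ← eval₂_hom, ← eval₂_hom, ← eval_map, ← eval_map, hQ, map_zero]
    simp only [eval_mul, eval_sub, eval_X, eval_C]
    nlinarith [mul_pos (mul_pos (sub_pos.2 hu) (sub_pos.2 hv)) hQpos]
  rw [hlt, map_mul, map_zero, ← eval₂_hom, ← eval₂_hom, ← eval_map, ← eval_map] at hneg
  obtain ⟨β, hβ, hβ', hPβ⟩ := h₂ _ _ _ ((hlt _ _).1 (hu.trans hv)) hneg
  refine hcd' β (by simpa [hP₂] using hPβ) ⟨lt_of_le_of_lt ?_ hβ, lt_of_lt_of_le hβ' ?_⟩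
  · exact not_lt.1 fun h2 => not_lt.2 hcu'.1 ((hlt _ _).2 h2)
  · exact not_lt.1 fun h2 => not_lt.2 hcu'.2 ((hlt _ _).2 h2)

theorem exists_root_eval₂_pos_iff (h₁ : PolynomialIVT K₁) (h₂ : PolynomialIVT K₂)
    (i₁ : E →+* K₁) (i₂ : E →+* K₂) (hi : ∀ e, 0 < i₁ e ↔ 0 < i₂ e) {P : E[X]} (hP : P.Monic)
    (H₁ : ∀ Q : E[X], Q ≠ 0 → Q.natDegree < P.natDegree →
      ∀ x, Q.eval₂ i₁ x = 0 → x ∈ i₁.range)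
    (H₂ : ∀ Q : E[X], Q ≠ 0 → Q.natDegree < P.natDegree →
      ∀ x, Q.eval₂ i₂ x = 0 → x ∈ i₂.range)
    {α : K₁} (hα : α ∉ i₁.range) (hPα : P.eval₂ i₁ α = 0) :
    ∃ β, ∀ T : E[X], 0 < T.eval₂ i₁ α ↔ 0 < T.eval₂ i₂ β := by
  obtain ⟨β, hβ, hl, hr⟩ := exists_root_same_cut h₁ h₂ i₁ i₂ hi hP H₁ hα hPα
  refine ⟨β, fun T => ?_⟩
  have hdeg : P ≠ 1 := fun h => by simp [h] at hPα
  have hT := natDegree_modByMonic_lt T hP hdeg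
  have e₁ : T.eval₂ i₁ α = (T %ₘ P).eval₂ i₁ α := by
    conv_lhs => rw [← modByMonic_add_div T P]
    simp [eval₂_mul, hPα]
  have e₂ : T.eval₂ i₂ β = (T %ₘ P).eval₂ i₂ β := by
    conv_lhs => rw [← modByMonic_add_div T P]
    simp [eval₂_mul, hβ]
  rw [e₁, e₂]
  exact eval₂_pos_iff_of_same_cut h₁ h₂ i₁ i₂ hi hl hr hα (P.natDegree - 1)
    (fun Q h h' => H₁ Q h (by omega)) (fun Q h h' => H₂ Q h (by omega)) _ (by omega)

end TwoFields
end CutComparison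

section CommonSubfield

open Polynomial

theorem roots_mem_range_of_maximal {E K₁ K₂ : Type*} [Field E]
    [Field K₁] [LinearOrder K₁] [IsStrictOrderedRing K₁]
    [Field K₂] [LinearOrder K₂] [IsStrictOrderedRing K₂]
    (h₁ : PolynomialIVT K₁) (h₂ : PolynomialIVT K₂)
    (i₁ : E →+* K₁) (i₂ : E →+* K₂) (hi : ∀ e, 0 < i₁ e ↔ 0 < i₂ e)
    (hmax : ∀ α β, (∀ T : E[X], 0 < T.eval₂ i₁ α ↔ 0 < T.eval₂ i₂ β) →
      α ∈ i₁.range ∧ β ∈ i₂.range) (Q : E[X]) (hQ : Q ≠ 0) :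
    (∀ x, Q.eval₂ i₁ x = 0 → x ∈ i₁.range) ∧ (∀ x, Q.eval₂ i₂ x = 0 → x ∈ i₂.range) := by
  induction hd : Q.natDegree using Nat.strong_induction_on generalizing Q with
  | _ d ih =>
    have hmon : (Q * C Q.leadingCoeff⁻¹).Monic := monic_mul_leadingCoeff_inv hQ
    have hdeg : (Q * C Q.leadingCoeff⁻¹).natDegree = d := by
      rw [natDegree_mul_leadingCoeff_inv Q hQ, hd]
    have H : ∀ T : E[X], T ≠ 0 → T.natDegree < (Q * C Q.leadingCoeff⁻¹).natDegree → _ :=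
      fun T hT hTd => ih T.natDegree (hdeg ▸ hTd) T hT rfl
    constructor
    · intro x hx
      by_contra hxr
      obtain ⟨β, hβ⟩ := exists_root_eval₂_pos_iff h₁ h₂ i₁ i₂ hi hmon
        (fun T hT hTd => (H T hT hTd).1) (fun T hT hTd => (H T hT hTd).2) hxr
        (by rw [eval₂_mul, hx, zero_mul])
      exact hxr (hmax x β hβ).1
    · intro x hx
      by_contra hxr
      obtain ⟨β, hβ⟩ := exists_root_eval₂_pos_iff h₂ h₁ i₂ i₁ (fun e => (hi e).symm) hmon
        (fun T hT hTd => (H T hT hTd).2) (fun T hT hTd => (H T hT hTd).1) hxr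
        (by rw [eval₂_mul, hx, zero_mul])
      exact hxr (hmax β x fun T => (hβ T).symm).2

/-- The subring of all fractions inside a field extension whose denominators come from a subring
of a product of two fields. -/
def Subring.prodFractions {K₁ K₂ : Type*} [Field K₁] [Field K₂] (G : Subring (K₁ × K₂)) :
    Subring (K₁ × K₂) where
  carrier := {x | ∃ a ∈ G, ∃ b ∈ G, b.1 ≠ 0 ∧ b.2 ≠ 0 ∧ x * b = a}
  zero_mem' := ⟨0, G.zero_mem, 1, G.one_mem, by simp, by simp, by simp⟩
  one_mem' := ⟨1, G.one_mem, 1, G.one_mem, by simp, by simp, by simp⟩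
  add_mem' := by
    rintro x y ⟨a, ha, b, hb, hb₁, hb₂, rfl⟩ ⟨c, hc, d, hd, hd₁, hd₂, rfl⟩
    exact ⟨_, G.add_mem (G.mul_mem ha hd) (G.mul_mem hc hb), _, G.mul_mem hb hd,
      mul_ne_zero hb₁ hd₁, mul_ne_zero hb₂ hd₂, by ring⟩
  mul_mem' := by
    rintro x y ⟨a, ha, b, hb, hb₁, hb₂, rfl⟩ ⟨c, hc, d, hd, hd₁, hd₂, rfl⟩
    exact ⟨_, G.mul_mem ha hc, _, G.mul_mem hb hd,
      mul_ne_zero hb₁ hd₁, mul_ne_zero hb₂ hd₂, by ring⟩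
  neg_mem' := by
    rintro x ⟨a, ha, b, hb, hb₁, hb₂, rfl⟩
    exact ⟨_, G.neg_mem ha, b, hb, hb₁, hb₂, by ring⟩

/-- A maximal common subfield: two homomorphisms to real closed fields inducing the same signs
factor through a common ordered subfield that is algebraically closed in both of them. -/
theorem exists_common_subfield {A : Type*} {K₁ K₂ : Type u} [CommRing A]
    [Field K₁] [LinearOrder K₁] [IsStrictOrderedRing K₁]
    [Field K₂] [LinearOrder K₂] [IsStrictOrderedRing K₂]
    (h₁ : PolynomialIVT K₁) (h₂ : PolynomialIVT K₂)
    (j₁ : A →+* K₁) (j₂ : A →+* K₂) (hj : ∀ a, 0 < j₁ a ↔ 0 < j₂ a) :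
    ∃ (E : Subfield K₁) (i₂ : E →+* K₂), (∀ e : E, 0 < E.subtype e ↔ 0 < i₂ e) ∧
      (∃ j : A →+* E, E.subtype.comp j = j₁ ∧ i₂.comp j = j₂) ∧
      ∀ Q : E[X], Q ≠ 0 → (∀ x, Q.eval₂ E.subtype x = 0 → x ∈ E.subtype.range) ∧
        (∀ x, Q.eval₂ i₂ x = 0 → x ∈ i₂.range) := by
  obtain ⟨G, hjG, hG⟩ := zorn_le_nonempty₀
    {G : Subring (K₁ × K₂) | ∀ g ∈ G, 0 < g.1 ↔ 0 < g.2} (by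
      intro c hc hchain G₀ hG₀
      refine ⟨sSup c, ?_, fun _ => le_sSup⟩
      intro g hg
      obtain ⟨G, hG, hgG⟩ := (Subring.mem_sSup_of_directedOn ⟨G₀, hG₀⟩ hchain.directedOn).1 hg
      exact hc hG g hgG) (j₁.prod j₂).range (by
      rintro _ ⟨a, rfl⟩
      exact hj a)
  have hpos : ∀ g ∈ G, 0 < g.1 ↔ 0 < g.2 := hG.prop
  have hzero : ∀ g ∈ G, g.1 = 0 ↔ g.2 = 0 := fun g hg => by
    have p₁ := hpos g hg
    have p₂ := hpos (-g) (G.neg_mem hg)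
    simp only [Prod.fst_neg, Prod.snd_neg, Left.neg_pos_iff] at p₂
    grind
  have hinj : ∀ g ∈ G, ∀ g' ∈ G, g.1 = g'.1 → g.2 = g'.2 := fun g hg g' hg' h => by
    simpa [sub_eq_zero] using (hzero (g - g') (G.sub_mem hg hg')).1 (by simp [h])
  have hfrac : G.prodFractions ≤ G := by
    refine hG.le_of_ge ?_ fun a ha => ⟨a, ha, 1, G.one_mem, by simp, by simp, by simp⟩
    rintro x ⟨a, ha, b, hb, hb₁, hb₂, rfl⟩
    have h := hpos _ (G.mul_mem ha hb)
    simp only [Prod.fst_mul, Prod.snd_mul, mul_assoc] at h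
    rwa [mul_pos_iff_of_pos_right (mul_self_pos.2 hb₁),
      mul_pos_iff_of_pos_right (mul_self_pos.2 hb₂)] at h
  let E : Subfield K₁ :=
    { G.map (RingHom.fst K₁ K₂) with
      inv_mem' := by
        rintro _ ⟨g, hg, rfl⟩
        by_cases h0 : g.1 = 0
        · exact ⟨0, G.zero_mem, by simp [h0]⟩
        · refine ⟨(g.1⁻¹, g.2⁻¹), hfrac ⟨1, G.one_mem, g, hg, h0, mt (hzero g hg).2 h0, ?_⟩, rfl⟩
          ext
          · simp [h0]
          · simp [mt (hzero g hg).2 h0] }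
  have hE : ∀ e : E, ∃ y, ((e : K₁), y) ∈ G := by
    rintro ⟨_, g, hg, rfl⟩
    exact ⟨g.2, hg⟩
  choose f hf using hE
  have hf' : ∀ (e : E) (y : K₂), ((e : K₁), y) ∈ G → f e = y := fun e y hy =>
    hinj _ (hf e) _ hy rfl
  let i₂ : E →+* K₂ :=
    { toFun := f
      map_one' := hf' 1 1 G.one_mem
      map_zero' := hf' 0 0 G.zero_mem
      map_add' := fun a b => hf' _ _ (G.add_mem (hf a) (hf b))
      map_mul' := fun a b => hf' _ _ (G.mul_mem (hf a) (hf b)) }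
  have hi : ∀ e : E, 0 < E.subtype e ↔ 0 < i₂ e := fun e => hpos _ (hf e)
  have hmem : ∀ a, (j₁ a, j₂ a) ∈ G := fun a => hjG ⟨a, rfl⟩
  refine ⟨E, i₂, hi, ⟨j₁.codRestrict E fun a => ⟨_, hmem a, rfl⟩, RingHom.ext fun a => rfl,
    RingHom.ext fun a => hf' _ _ (hmem a)⟩,
    roots_mem_range_of_maximal h₁ h₂ _ _ hi fun α β hαβ => ?_⟩
  · have hle : ((eval₂RingHom E.subtype α).prod (eval₂RingHom i₂ β)).range ≤ G := by
      refine hG.le_of_ge ?_ fun g hg => ⟨C ⟨g.1, g, hg, rfl⟩, ?_⟩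
      · rintro _ ⟨T, rfl⟩
        exact hαβ T
      · refine Prod.ext (by simp) ?_
        exact (eval₂_C _ _).trans (hf' ⟨g.1, g, hg, rfl⟩ g.2 hg)
    have hX : (α, β) ∈ G := hle ⟨X, by simp⟩
    exact ⟨⟨⟨α, _, hX, rfl⟩, rfl⟩, ⟨⟨α, _, hX, rfl⟩, hf' _ _ hX⟩⟩

theorem PolynomialIVT.of_roots_mem_range {E K : Type*} [Field E] [LinearOrder E]
    [Field K] [LinearOrder K]
    (hK : PolynomialIVT K) (i : E →+* K) (hi : StrictMono i)
    (H : ∀ Q : E[X], Q ≠ 0 → ∀ x, Q.eval₂ i x = 0 → x ∈ i.range) : PolynomialIVT E := by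
  intro P a b hab hP
  have hP0 : P ≠ 0 := by
    rintro rfl
    simp at hP
  obtain ⟨c, hac, hcb, hc⟩ := hK (P.map i) (i a) (i b) (hi hab) (by
    rw [eval_map, eval_map, eval₂_hom, eval₂_hom, ← map_mul, ← map_zero i]
    exact hi hP)
  rw [eval_map] at hc
  obtain ⟨e, rfl⟩ := H P hP0 c hc
  rw [eval₂_hom, map_eq_zero] at hc
  exact ⟨e, hi.lt_iff_lt.1 hac, hi.lt_iff_lt.1 hcb, hc⟩

/-- A real closed field is algebraically closed in every larger real closed field. -/
theorem PolynomialIVT.roots_mem_range {R K : Type u}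
    [Field R] [LinearOrder R] [IsStrictOrderedRing R]
    [Field K] [LinearOrder K] [IsStrictOrderedRing K]
    (hR : PolynomialIVT R) (hK : PolynomialIVT K) (i : R →+* K) (hi : StrictMono i)
    (Q : R[X]) (hQ : Q ≠ 0) (x : K) (hx : Q.eval₂ i x = 0) : x ∈ i.range := by
  obtain ⟨E, i₂, hpos, ⟨j, hj, hj₂⟩, hroot⟩ := exists_common_subfield hR hK (RingHom.id R) i
    (fun a => by rw [← map_zero i, hi.lt_iff_lt, RingHom.id_apply])
  obtain ⟨e, rfl⟩ := (hroot (Q.map j) ((Polynomial.map_ne_zero_iff j.injective).2 hQ)).2 x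
    (by rw [eval₂_map, hj₂, hx])
  refine ⟨E.subtype e, ?_⟩
  rw [← hj₂, RingHom.comp_apply]
  congr 1
  exact E.subtype.injective (RingHom.congr_fun hj _)

end CommonSubfield

section Ultrapower

open Polynomial Filter

theorem PolynomialIVT.germ {I : Type*} {R : Type*} [Field R] [LinearOrder R]
    [IsStrictOrderedRing R] (hR : PolynomialIVT R) (𝓤 : Ultrafilter I) :
    PolynomialIVT (Germ (𝓤 : Filter I) R) := by
  intro P a b hab hP
  obtain ⟨P, rfl⟩ := Polynomial.map_surjective
    (Germ.coeRingHom (𝓤 : Filter I) : (I → R) →+* _) (fun x => Quotient.exists_rep x) P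
  have heval : ∀ (c : I → R), (P.map (Germ.coeRingHom (𝓤 : Filter I))).eval
      (c : Germ (𝓤 : Filter I) R) =
      ((fun s => (P.map (Pi.evalRingHom _ s)).eval (c s) : I → R) : Germ (𝓤 : Filter I) R) := by
    intro c
    rw [eval_map]
    have := eval₂_hom (p := P) (Germ.coeRingHom (𝓤 : Filter I)) c
    refine this.trans (congrArg _ (funext fun s => ?_))
    rw [eval_map]
    exact (eval₂_hom (p := P) (Pi.evalRingHom _ s) c).symm
  induction a using Germ.inductionOn with | _ a
  induction b using Germ.inductionOn with | _ b
  rw [heval, heval, ← Germ.coe_mul, ← Germ.coe_zero, Germ.coe_lt] at hP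
  rw [Germ.coe_lt] at hab
  have hex : ∀ s, ∃ c, a s < b s → (P.map (Pi.evalRingHom _ s)).eval (a s) *
      (P.map (Pi.evalRingHom _ s)).eval (b s) < 0 →
      a s < c ∧ c < b s ∧ (P.map (Pi.evalRingHom _ s)).eval c = 0 := fun s => by
    by_cases h : a s < b s ∧ (P.map (Pi.evalRingHom _ s)).eval (a s) *
      (P.map (Pi.evalRingHom _ s)).eval (b s) < 0
    · obtain ⟨c, hc⟩ := hR _ _ _ h.1 h.2
      exact ⟨c, fun _ _ => hc⟩
    · exact ⟨0, fun h₁ h₂ => absurd ⟨h₁, h₂⟩ h⟩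
  choose c hc using hex
  refine ⟨(c : Germ (𝓤 : Filter I) R), ?_, ?_, ?_⟩
  · rw [Germ.coe_lt]
    filter_upwards [hab, hP] with s h₁ h₂ using (hc s h₁ h₂).1
  · rw [Germ.coe_lt]
    filter_upwards [hab, hP] with s h₁ h₂ using (hc s h₁ h₂).2.1
  · rw [heval, ← Germ.coe_zero, Germ.coe_eq]
    filter_upwards [hab, hP] with s h₁ h₂ using (hc s h₁ h₂).2.2

/-- Every cut of an ordered field is realised in an ultrapower. -/
theorem exists_germ_same_cut {R : Type*} {K : Type*} [Field R] [LinearOrder R]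
    [IsStrictOrderedRing R] [Field K] [LinearOrder K] [IsStrictOrderedRing K]
    (i : R →+* K) (hi : StrictMono i) (x : K) :
    ∃ (𝓤 : Ultrafilter (Finset R)) (a : Finset R → R),
      (∀ e, i e < x → ∀ᶠ s in (𝓤 : Filter (Finset R)), e < a s) ∧
      (∀ e, x < i e → ∀ᶠ s in (𝓤 : Filter (Finset R)), a s < e) := by
  classical
  have hex : ∀ s : Finset R, ∃ a, ∀ e ∈ s, (i e < x → e < a) ∧ (x < i e → a < e) := fun s => by
    obtain ⟨a, ha, ha'⟩ := Order.exists_between_finsets (s.filter fun e => i e < x)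
      (s.filter fun e => x < i e) fun e he e' he' => hi.lt_iff_lt.1
        ((Finset.mem_filter.1 he).2.trans (Finset.mem_filter.1 he').2)
    exact ⟨a, fun e he => ⟨fun h => ha e (Finset.mem_filter.2 ⟨he, h⟩),
      fun h => ha' e (Finset.mem_filter.2 ⟨he, h⟩)⟩⟩
  choose a ha using hex
  have hmem : ∀ e, ∀ᶠ s in (Ultrafilter.of (atTop : Filter (Finset R)) : Filter (Finset R)),
      e ∈ s := fun e => by
    refine Ultrafilter.of_le _ ?_
    filter_upwards [eventually_ge_atTop {e}] with s hs using Finset.singleton_subset_iff.1 hs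
  exact ⟨Ultrafilter.of atTop, a, fun e he => (hmem e).mono fun s hs => (ha s e hs).1 he,
    fun e he => (hmem e).mono fun s hs => (ha s e hs).2 he⟩

theorem exists_germ_eval₂_pos_iff {R K : Type u} [Field R] [LinearOrder R]
    [IsStrictOrderedRing R] [Field K] [LinearOrder K] [IsStrictOrderedRing K]
    (hR : PolynomialIVT R) (hK : PolynomialIVT K)
    (i : R →+* K) (hi : StrictMono i) (x : K) (hx : x ∉ i.range) :
    ∃ (𝓤 : Ultrafilter (Finset R)) (a : Finset R → R), ∀ T : R[X],
      0 < T.eval₂ i x ↔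
        0 < (Germ.ofFun fun s => T.eval (a s) : Germ (𝓤 : Filter (Finset R)) R) := by
  obtain ⟨𝓤, a, ha, ha'⟩ := exists_germ_same_cut i hi x
  refine ⟨𝓤, a, fun T => ?_⟩
  let c : R →+* Germ (𝓤 : Filter (Finset R)) R :=
    (Germ.coeRingHom _).comp (Pi.constRingHom (Finset R) R)
  have hc : StrictMono c := fun r r' h => Germ.coe_lt.2 (Eventually.of_forall fun _ => h)
  have key := eval₂_pos_iff_of_same_cut hK (hR.germ 𝓤) i c
    (fun e => by rw [← map_zero i, hi.lt_iff_lt, ← map_zero c, hc.lt_iff_lt])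
    (β := (Germ.ofFun a : Germ (𝓤 : Filter (Finset R)) R))
    (fun e he => Germ.coe_lt.2 (ha e he)) (fun e he => Germ.coe_lt.2 (ha' e he)) hx T.natDegree
    (fun Q hQ _ => hR.roots_mem_range hK i hi Q hQ)
    (fun Q hQ _ => hR.roots_mem_range (hR.germ 𝓤) c hc Q hQ) T le_rfl
  rw [key]
  have : T.eval₂ c (Germ.ofFun a : Germ (𝓤 : Filter (Finset R)) R) =
      (Germ.ofFun fun s => T.eval (a s) : Germ (𝓤 : Filter (Finset R)) R) := by
    have h := hom_eval₂ T (Pi.constRingHom (Finset R) R) (Germ.coeRingHom (𝓤 : Filter _)) a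
    refine h.symm.trans (congrArg _ (funext fun s => ?_))
    exact hom_eval₂ T (Pi.constRingHom (Finset R) R) (Pi.evalRingHom _ s) a
  rw [this]

end Ultrapower

section TarskiTransfer

open Filter

theorem MvPolynomial.hom_eval₂_cons {n : ℕ} {R S T : Type*} [CommRing R] [CommRing S] [CommRing T]
    (j : R →+* S) (e : S) (i : S →+* T) (y : Fin n → T) (p : MvPolynomial (Fin (n + 1)) R) :
    (p.eval₂ (MvPolynomial.C.comp j) (Fin.cons (MvPolynomial.C e) MvPolynomial.X)).eval₂ i y =
      p.eval₂ (i.comp j) (Fin.cons (i e) y : Fin (n + 1) → T) := by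
  have h := MvPolynomial.hom_eval₂ p (MvPolynomial.C.comp j) (MvPolynomial.eval₂Hom i y)
    (Fin.cons (MvPolynomial.C e) MvPolynomial.X)
  rw [MvPolynomial.coe_eval₂Hom] at h
  rw [h]
  congr 1
  · ext r
    simp
  · funext k
    refine Fin.cases ?_ (fun k => ?_) k <;> simp

/-- Tarski's transfer principle for systems of polynomial inequalities. -/
theorem PolynomialIVT.exists_eval_nonneg {ι : Type*} [Finite ι] {n : ℕ} {R K : Type u}
    [Field R] [LinearOrder R] [IsStrictOrderedRing R]
    [Field K] [LinearOrder K] [IsStrictOrderedRing K]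
    (hR : PolynomialIVT R) (hK : PolynomialIVT K) (i : R →+* K) (hi : StrictMono i)
    (p : ι → MvPolynomial (Fin n) R) (x : Fin n → K) (hx : ∀ k, 0 ≤ (p k).eval₂ i x) :
    ∃ y : Fin n → R, ∀ k, 0 ≤ MvPolynomial.eval y (p k) := by
  induction n generalizing R with
  | zero =>
    refine ⟨Fin.elim0, fun k => ?_⟩
    rw [← hi.le_iff_le, map_zero]
    refine (hx k).trans_eq ?_
    have h := MvPolynomial.hom_eval₂ (p k) (RingHom.id R) i Fin.elim0
    rw [RingHom.comp_id] at h
    exact (congrArg (fun z => (p k).eval₂ i z) (Subsingleton.elim _ _)).trans h.symm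
  | succ n ih =>
    by_cases hx0 : x 0 ∈ i.range
    · obtain ⟨r, hr⟩ := hx0
      obtain ⟨y, hy⟩ := ih hR i hi (fun k => (p k).eval₂ (MvPolynomial.C.comp (RingHom.id R))
        (Fin.cons (MvPolynomial.C r) MvPolynomial.X)) (Fin.tail x) fun k => by
          rw [MvPolynomial.hom_eval₂_cons, hr, Fin.cons_self_tail]
          exact hx k
      refine ⟨Fin.cons r y, fun k => (hy k).trans_eq ?_⟩
      exact MvPolynomial.hom_eval₂_cons (RingHom.id R) r (RingHom.id R) y (p k)
    · obtain ⟨𝓤, a, ha⟩ := exists_germ_eval₂_pos_iff hR hK i hi (x 0) hx0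
      obtain ⟨E, i₂, hpos, ⟨j, hj, hj₂⟩, hroot⟩ := exists_common_subfield hK (hR.germ 𝓤)
        (Polynomial.eval₂RingHom i (x 0))
        ((Germ.coeRingHom (𝓤 : Filter (Finset R))).comp
          (RingHom.pi fun s => Polynomial.evalRingHom (a s))) ha
      have hE : StrictMono E.subtype := fun _ _ h => h
      have hj₁ : E.subtype.comp (j.comp Polynomial.C) = i := by
        rw [← RingHom.comp_assoc, hj]
        ext r
        simp
      have hjX : E.subtype (j Polynomial.X) = x 0 := by
        rw [← RingHom.comp_apply, hj]
        simp
      obtain ⟨y, hy⟩ := ih (hK.of_roots_mem_range E.subtype hE fun Q hQ => (hroot Q hQ).1)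
        E.subtype hE (fun k => (p k).eval₂ (MvPolynomial.C.comp (j.comp Polynomial.C))
        (Fin.cons (MvPolynomial.C (j Polynomial.X)) MvPolynomial.X)) (Fin.tail x) fun k => by
          rw [MvPolynomial.hom_eval₂_cons, hj₁, hjX, Fin.cons_self_tail]
          exact hx k
      choose b hb using fun m => Quotient.exists_rep (i₂ (y m))
      have key : ∀ k, ∀ᶠ s in (𝓤 : Filter (Finset R)),
          0 ≤ MvPolynomial.eval (Fin.cons (a s) fun m => b m s : Fin (n + 1) → R) (p k) := by
        intro k
        have h₀ : ¬ (i₂ (MvPolynomial.eval y ((p k).eval₂ (MvPolynomial.C.comp (j.comp Polynomial.C))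
          (Fin.cons (MvPolynomial.C (j Polynomial.X)) MvPolynomial.X))) < 0) := by
          rw [← Left.neg_pos_iff, ← map_neg, ← hpos, map_neg, Left.neg_pos_iff]
          exact not_lt.2 (hy k)
        have h₁ : i₂ (MvPolynomial.eval y ((p k).eval₂ (MvPolynomial.C.comp (j.comp Polynomial.C))
          (Fin.cons (MvPolynomial.C (j Polynomial.X)) MvPolynomial.X))) =
          (Germ.ofFun fun s => MvPolynomial.eval (Fin.cons (a s) fun m => b m s : Fin (n + 1) → R)
            (p k) : Germ (𝓤 : Filter (Finset R)) R) := by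
          have e₁ := MvPolynomial.hom_eval₂_cons (j.comp Polynomial.C) (j Polynomial.X)
            (RingHom.id E) y (p k)
          have e₂ := MvPolynomial.hom_eval₂ (p k) ((RingHom.id E).comp (j.comp Polynomial.C)) i₂
            (Fin.cons (j Polynomial.X) y)
          have e₃ := MvPolynomial.hom_eval₂ (p k) (Pi.constRingHom (Finset R) R)
            (Germ.coeRingHom (𝓤 : Filter (Finset R))) (Fin.cons a b : Fin (n + 1) → Finset R → R)
          refine ((congrArg i₂ e₁).trans e₂).trans (Eq.trans ?_ (e₃.symm.trans ?_))
          · congr 1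
            · rw [RingHom.id_comp, ← RingHom.comp_assoc, hj₂]
              exact RingHom.ext fun r => congrArg (Germ.coeRingHom (𝓤 : Filter (Finset R)))
                (funext fun s => Polynomial.eval_C)
            · funext m
              refine Fin.cases ?_ (fun m => ?_) m
              · exact (RingHom.congr_fun hj₂ Polynomial.X).trans (congrArg
                  (Germ.coeRingHom (𝓤 : Filter (Finset R))) (funext fun s => Polynomial.eval_X))
              · exact (hb m).symm
          · refine congrArg _ (funext fun s => ?_)
            have e₄ := MvPolynomial.hom_eval₂ (p k) (Pi.constRingHom (Finset R) R)
              (Pi.evalRingHom _ s) (Fin.cons a b : Fin (n + 1) → Finset R → R)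
            refine e₄.trans ?_
            congr 1
            funext m
            refine Fin.cases ?_ (fun m => ?_) m <;> simp
        rw [h₁, not_lt, ← Germ.coe_zero] at h₀
        exact Germ.coe_le.1 h₀
      obtain ⟨s, hs⟩ := (eventually_all.2 key).exists
      exact ⟨_, hs⟩

end TarskiTransfer

section ArtinSchreier

open Polynomial

theorem IsSumSq.map_ringHom {R S : Type*} [Semiring R] [Semiring S] (f : R →+* S) {x : R}
    (hx : IsSumSq x) : IsSumSq (f x) := by
  induction hx with
  | zero => simp
  | sq_add a _ ih =>
    rw [map_add, map_mul]
    exact (IsSumSq.mul_self _).add ih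

/-- The real part of a sum of squares in `R[√a]`. -/
theorem IsSumSq.exists_re_eq {R : Type*} [CommRing R] {a : R} {z : QuadraticAlgebra R a 0}
    (hz : IsSumSq z) : ∃ σ τ : R, IsSumSq σ ∧ IsSumSq τ ∧ z.re = σ + a * τ := by
  induction hz with
  | zero => exact ⟨0, 0, .zero, .zero, by simp⟩
  | sq_add x _ ih =>
    obtain ⟨σ, τ, hσ, hτ, h⟩ := ih
    refine ⟨_, _, (IsSumSq.mul_self x.re).add hσ, (IsSumSq.mul_self x.im).add hτ, ?_⟩
    simp [h]
    ring

/-- A ring in which `-1` is not a sum of squares maps to a field with the same property. -/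
theorem exists_ringHom_field_not_isSumSq {B : Type u} [CommRing B] (hB : ¬ IsSumSq (-1 : B)) :
    ∃ (K : Type u) (_ : Field K) (_ : B →+* K), ¬ IsSumSq (-1 : K) := by
  let M : Submonoid B :=
    { carrier := {x | ∃ σ, IsSumSq σ ∧ x = 1 + σ}
      one_mem' := ⟨0, .zero, by simp⟩
      mul_mem' := by
        rintro _ _ ⟨σ, hσ, rfl⟩ ⟨τ, hτ, rfl⟩
        exact ⟨σ + τ + σ * τ, (hσ.add hτ).add (hσ.mul hτ), by ring⟩ }
  have hM : (0 : B) ∉ M := by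
    rintro ⟨σ, hσ, h⟩
    rw [← neg_eq_of_add_eq_zero_right h.symm] at hσ
    exact hB hσ
  have : Nontrivial (Localization M) := by
    refine nontrivial_of_ne 0 1 fun h => hM ?_
    rw [← map_zero (algebraMap B (Localization M)), ← map_one (algebraMap B (Localization M)),
      IsLocalization.eq_iff_exists M] at h
    obtain ⟨⟨c, hc⟩, h⟩ := h
    simp at h
    rwa [← h] at hc
  have hunit : ∀ y : Localization M, IsSumSq y → IsUnit (1 + y) := by
    intro y hy
    have key : ∃ m ∈ M, ∃ σ, IsSumSq σ ∧ y * algebraMap B _ (m * m) = algebraMap B _ σ := by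
      induction hy with
      | zero => exact ⟨1, M.one_mem, 0, .zero, by simp⟩
      | sq_add x _ ih =>
        obtain ⟨m, hm, σ, hσ, h⟩ := ih
        obtain ⟨⟨b, c⟩, hx⟩ := IsLocalization.surj M x
        refine ⟨m * c, M.mul_mem hm c.2, (b * m) * (b * m) + σ * (c * c),
          (IsSumSq.mul_self _).add (hσ.mul (IsSumSq.mul_self _)), ?_⟩
        simp only [map_mul, map_add] at h hx ⊢
        rw [← hx, ← h]
        ring
    obtain ⟨m, hm, σ, hσ, h⟩ := key
    have hmem : m * m + σ ∈ M := by
      obtain ⟨τ, hτ, h⟩ := M.mul_mem hm hm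
      exact ⟨τ + σ, hτ.add hσ, by rw [h]; ring⟩
    refine isUnit_of_mul_isUnit_left (y := algebraMap B _ (m * m)) ?_
    rw [add_mul, h, one_mul, ← map_add]
    exact IsLocalization.map_units _ ⟨_, hmem⟩
  obtain ⟨I, hI⟩ := Ideal.exists_maximal (Localization M)
  refine ⟨Localization M ⧸ I, Ideal.Quotient.field I,
    (Ideal.Quotient.mk I).comp (algebraMap B _), fun h => ?_⟩
  have hlift : ∀ z : Localization M ⧸ I, IsSumSq z →
      ∃ y, IsSumSq y ∧ Ideal.Quotient.mk I y = z := by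
    intro z hz
    induction hz with
    | zero => exact ⟨0, .zero, map_zero _⟩
    | sq_add x _ ih =>
      obtain ⟨y, hy, rfl⟩ := ih
      obtain ⟨x, rfl⟩ := Ideal.Quotient.mk_surjective x
      exact ⟨_, (IsSumSq.mul_self x).add hy, by simp⟩
  obtain ⟨y, hy, hy'⟩ := hlift _ h
  refine hI.ne_top (Ideal.eq_top_of_isUnit_mem I (Ideal.Quotient.eq_zero_iff_mem.1 ?_) (hunit y hy))
  rw [map_add, hy', map_one, add_neg_cancel]

/-- Every field in which `-1` is not a sum of squares has a maximal algebraic extension with this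
property. -/
theorem exists_maximal_not_isSumSq_extension {K : Type u} [Field K] (hK : ¬ IsSumSq (-1 : K)) :
    ∃ (E : Type u) (_ : Field E) (_ : K →+* E), ¬ IsSumSq (-1 : E) ∧
      ∀ P : E[X], Irreducible P → (∀ x, P.eval x ≠ 0) → IsSumSq (-1 : AdjoinRoot P) := by
  have hrange : ∀ {L : Type u} [Field L] (f : L →+* AlgebraicClosure K), ¬ IsSumSq (-1 : L) →
      ¬ IsSumSq (-1 : f.fieldRange) := by
    intro L _ f hL h
    have e := RingEquiv.ofBijective f.rangeRestrictField
      ⟨fun a b hab => f.injective (congrArg Subtype.val hab), fun ⟨_, x, hx⟩ => ⟨x, Subtype.ext hx⟩⟩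
    have := h.map_ringHom (e.symm : f.fieldRange →+* L)
    rw [map_neg, map_one] at this
    exact hL this
  obtain ⟨E, hKE, hE⟩ := zorn_le_nonempty₀
    {F : Subfield (AlgebraicClosure K) | ¬ IsSumSq (-1 : F)} (by
      intro c hc hchain F₀ hF₀
      refine ⟨sSup c, fun h => ?_, fun _ => le_sSup⟩
      have key : ∀ z : (sSup c : Subfield (AlgebraicClosure K)), IsSumSq z →
          ∃ F ∈ c, ∃ w : F, IsSumSq w ∧ (w : AlgebraicClosure K) = z := by
        intro z hz
        induction hz with
        | zero => exact ⟨F₀, hF₀, 0, .zero, rfl⟩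
        | sq_add x _ ih =>
          obtain ⟨F, hF, w, hw, h⟩ := ih
          obtain ⟨F', hF', hx⟩ := (Subfield.mem_sSup_of_directedOn ⟨F₀, hF₀⟩
            hchain.directedOn).1 x.2
          obtain ⟨F'', hF'', hle, hle'⟩ := hchain.directedOn F hF F' hF'
          refine ⟨F'', hF'', _, (IsSumSq.mul_self ⟨(x : AlgebraicClosure K), hle' hx⟩).add
            (hw.map_ringHom (Subfield.inclusion hle)), ?_⟩
          rw [Subfield.coe_add, Subfield.coe_add, ← h]
          rfl
      obtain ⟨F, hF, w, hw, h⟩ := key _ h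
      refine hc hF ?_
      have hw' : w = -1 := Subtype.ext h
      rwa [hw'] at hw) _ (hrange (algebraMap K (AlgebraicClosure K)) hK)
  refine ⟨E, inferInstance, (algebraMap K (AlgebraicClosure K)).codRestrict E
    fun x => hKE ⟨x, rfl⟩, hE.prop, fun P hP hroot => ?_⟩
  by_contra hno
  have : Fact (Irreducible P) := ⟨hP⟩
  obtain ⟨θ, hθ⟩ := IsAlgClosed.exists_eval₂_eq_zero E.subtype P (degree_pos_of_irreducible hP).ne'
  have hle := hE.le_of_ge (hrange (AdjoinRoot.lift E.subtype θ hθ) hno)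
    (fun e he => ⟨AdjoinRoot.of P ⟨e, he⟩, by simp⟩)
  have hθE : θ ∈ E := hle ⟨AdjoinRoot.root P, by simp⟩
  refine hroot ⟨θ, hθE⟩ (E.subtype.injective ?_)
  rw [map_zero, ← eval₂_hom]
  exact hθ

theorem exists_polynomialIVT_order {E : Type u} [Field E] (hE : ¬ IsSumSq (-1 : E))
    (hmax : ∀ P : E[X], Irreducible P → (∀ x, P.eval x ≠ 0) → IsSumSq (-1 : AdjoinRoot P)) :
    ∃ (_ : LinearOrder E) (_ : IsStrictOrderedRing E), PolynomialIVT E := by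
  classical
  have hsq : ∀ a : E, ¬ IsSquare a → ∃ σ τ : E, IsSumSq σ ∧ IsSumSq τ ∧ -1 = σ + a * τ := by
    intro a ha
    have hroot : ∀ x, (X ^ 2 - C a).eval x ≠ 0 := fun x hx => ha ⟨x, by
      simp only [eval_sub, eval_pow, eval_X, eval_C] at hx
      linear_combination -hx⟩
    have hdeg : (X ^ 2 - C a).natDegree = 2 := natDegree_X_pow_sub_C
    have hirr : Irreducible (X ^ 2 - C a) := by
      refine irreducible_of_degree_le_three_of_not_isRoot (by simp [hdeg]) hroot
    have h := (hmax _ hirr hroot).map_ringHom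
      (AdjoinRoot.lift (algebraMap E (QuadraticAlgebra E a 0)) QuadraticAlgebra.omega (by
        simp [sq, QuadraticAlgebra.ext_iff]))
    rw [map_neg, map_one] at h
    exact h.exists_re_eq
  have hsum : ∀ a : E, IsSumSq a → IsSquare a := by
    intro a ha
    by_contra h
    obtain ⟨σ, τ, hσ, hτ, h⟩ := hsq a h
    exact hE (h ▸ hσ.add (ha.mul hτ))
  have htotal : ∀ a : E, IsSquare a ∨ IsSquare (-a) := by
    intro a
    by_cases h : IsSquare a
    · exact .inl h
    · obtain ⟨σ, τ, hσ, hτ, h⟩ := hsq a h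
      have hτ0 : τ ≠ 0 := by
        rintro rfl
        rw [mul_zero, add_zero] at h
        exact hE (h ▸ hσ)
      right
      apply hsum
      have : -a = (1 + σ) * τ * (τ⁻¹ * τ⁻¹) := by
        field_simp
        linear_combination h
      rw [this]
      exact ((IsSumSq.one.add hσ).mul hτ).mul (IsSumSq.mul_self _)
  let C₀ : RingCone E :=
    { carrier := {x | IsSquare x}
      zero_mem' := IsSquare.zero
      one_mem' := IsSquare.one
      add_mem' := fun {a b} ha hb => hsum _ (ha.isSumSq.add hb.isSumSq)
      mul_mem' := fun {a b} ha hb => ha.mul hb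
      eq_zero_of_mem_of_neg_mem' := fun {a} ha hb => by
        by_contra h0
        refine hE ?_
        have : (-1 : E) = a * -a * (a⁻¹ * a⁻¹) := by field_simp
        rw [this]
        exact (IsSquare.isSumSq ha).mul (IsSquare.isSumSq hb) |>.mul (IsSumSq.mul_self _) }
  have hC₀ : HasMemOrNegMem C₀ := ⟨htotal⟩
  let _ : LinearOrder E := LinearOrder.mkOfAddGroupCone C₀
  have _ : IsOrderedRing E := IsOrderedRing.mkOfCone C₀
  have hstrict : IsStrictOrderedRing E := IsOrderedRing.toIsStrictOrderedRing E
  refine ⟨inferInstance, hstrict, fun P a b hab hP => ?_⟩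
  induction hd : P.natDegree using Nat.strong_induction_on generalizing P with
  | _ d ih =>
    have hP0 : P ≠ 0 := by
      rintro rfl
      simp at hP
    by_cases hroot : ∃ x, P.eval x = 0
    · obtain ⟨x, hx⟩ := hroot
      by_cases hxab : a < x ∧ x < b
      · exact ⟨x, hxab.1, hxab.2, hx⟩
      obtain ⟨T, rfl⟩ := dvd_iff_isRoot.2 hx
      have hT0 : T ≠ 0 := right_ne_zero_of_mul hP0
      simp only [eval_mul, eval_sub, eval_X, eval_C] at hP
      have hpos : 0 ≤ (a - x) * (b - x) := by
        by_contra! hneg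
        refine hxab ⟨?_, ?_⟩ <;> by_contra! hle
        · exact hneg.not_ge (mul_nonneg (by linarith) (by linarith))
        · exact hneg.not_ge (mul_nonneg_of_nonpos_of_nonpos (by linarith) (by linarith))
      have hT : T.eval a * T.eval b < 0 := by
        by_contra! h
        nlinarith [mul_nonneg hpos h]
      obtain ⟨c, h₁, h₂, h₃⟩ := ih T.natDegree (by
        rw [← hd, natDegree_mul (X_sub_C_ne_zero x) hT0, natDegree_X_sub_C]
        omega) T hT rfl
      exact ⟨c, h₁, h₂, by rw [eval_mul, h₃, mul_zero]⟩
    push Not at hroot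
    exfalso
    have hunit : ¬ IsUnit P := fun h => by
      obtain ⟨r, -, rfl⟩ := isUnit_iff.1 h
      simp only [eval_C] at hP
      exact hP.not_ge (mul_self_nonneg r)
    by_cases hirr : Irreducible P
    · have key : ∀ z : AdjoinRoot P, IsSumSq z → ∃ T : E[X], AdjoinRoot.mk P T = z ∧
          T.natDegree ≤ 2 * (P.natDegree - 1) ∧ ∀ c, 0 ≤ T.eval c := by
        intro z hz
        induction hz with
        | zero => exact ⟨0, by simp⟩
        | sq_add x _ ih =>
          obtain ⟨T, rfl, hT, hT'⟩ := ih
          obtain ⟨x, rfl⟩ := AdjoinRoot.mk_surjective x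
          refine ⟨(x % P) * (x % P) + T, ?_, ?_, fun c => ?_⟩
          · have : AdjoinRoot.mk P (x % P) = AdjoinRoot.mk P x := by
              rw [AdjoinRoot.mk_eq_mk]
              exact ⟨-(x / P), by linear_combination EuclideanDomain.div_add_mod x P⟩
            rw [map_add, map_mul, this]
          · have hlt : (x % P).natDegree < P.natDegree :=
              natDegree_mod_lt x
                (natDegree_pos_iff_degree_pos.2 (degree_pos_of_irreducible hirr)).ne'
            refine natDegree_add_le_of_degree_le (natDegree_mul_le.trans ?_) hT
            omega
          · rw [eval_add, eval_mul]
            exact add_nonneg (mul_self_nonneg _) (hT' c)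
      obtain ⟨T, hT, hTd, hTpos⟩ := key _ (hmax P hirr hroot)
      have hdvd : P ∣ 1 + T := by
        rw [← AdjoinRoot.mk_eq_zero, map_add, hT, map_one, add_neg_cancel]
      obtain ⟨S, hS⟩ := hdvd
      have heval : ∀ c, 0 < P.eval c * S.eval c := fun c => by
        rw [← eval_mul, ← hS, eval_add, eval_one]
        linarith [hTpos c]
      have hS0 : S ≠ 0 := by
        rintro rfl
        simpa using heval 0
      have hSd : S.natDegree < d := by
        have h₁ : (1 + T).natDegree ≤ 2 * (P.natDegree - 1) :=
          natDegree_add_le_of_degree_le (by simp) hTd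
        rw [hS, natDegree_mul hP0 hS0] at h₁
        have := natDegree_pos_iff_degree_pos.2 (degree_pos_of_irreducible hirr)
        omega
      obtain ⟨c, -, -, hc⟩ := ih _ hSd S (by
        have h₁ := mul_pos (heval a) (heval b)
        by_contra! h
        nlinarith [mul_nonneg_of_nonpos_of_nonpos hP.le (neg_nonpos.2 h)]) rfl
      have := heval c
      rw [hc, mul_zero] at this
      exact lt_irrefl _ this
    · obtain ⟨S, T, hS, hT, rfl⟩ : ∃ S T, ¬ IsUnit S ∧ ¬ IsUnit T ∧ P = S * T := by
        simp only [irreducible_iff, hunit, not_false_eq_true, true_and] at hirr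
        push Not at hirr
        obtain ⟨S, T, h, hS, hT⟩ := hirr
        exact ⟨S, T, hS, hT, h⟩
      have hS0 := left_ne_zero_of_mul hP0
      have hT0 := right_ne_zero_of_mul hP0
      have hSd := natDegree_pos_iff_degree_pos.2 (degree_pos_of_ne_zero_of_nonunit hS0 hS)
      have hTd := natDegree_pos_iff_degree_pos.2 (degree_pos_of_ne_zero_of_nonunit hT0 hT)
      rw [natDegree_mul hS0 hT0] at hd
      simp only [eval_mul] at hP hroot
      rcases lt_or_ge (S.eval a * S.eval b) 0 with h | h
      · obtain ⟨c, -, -, hc⟩ := ih _ (by omega) S h rfl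
        exact hroot c (by rw [hc, zero_mul])
      · obtain ⟨c, -, -, hc⟩ := ih _ (by omega) T (by
          by_contra! h'
          nlinarith [mul_nonneg h h']) rfl
        exact hroot c (by rw [hc, mul_zero])

/-- A ring in which `-1` is not a sum of squares maps to a real closed field. -/
theorem exists_ringHom_polynomialIVT {B : Type u} [CommRing B] (hB : ¬ IsSumSq (-1 : B)) :
    ∃ (K : Type u) (_ : Field K) (_ : LinearOrder K) (_ : IsStrictOrderedRing K) (_ : B →+* K),
      PolynomialIVT K := by
  obtain ⟨K, _, f, hK⟩ := exists_ringHom_field_not_isSumSq hB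
  obtain ⟨E, _, g, hE, hmax⟩ := exists_maximal_not_isSumSq_extension hK
  obtain ⟨_, _, h⟩ := exists_polynomialIVT_order hE hmax
  exact ⟨E, _, _, inferInstance, g.comp f, h⟩

end ArtinSchreier

section Positivstellensatz

theorem polynomialIVT_real : PolynomialIVT ℝ := by
  intro P a b hab hP
  obtain ⟨c, hc, hc0⟩ : ∃ c ∈ Set.Icc a b, P.eval c = 0 := by
    rcases mul_neg_iff.1 hP with ⟨ha, hb⟩ | ⟨ha, hb⟩
    · exact intermediate_value_Icc' hab.le P.continuousOn ⟨hb.le, ha.le⟩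
    · exact intermediate_value_Icc hab.le P.continuousOn ⟨ha.le, hb.le⟩
  refine ⟨c, lt_of_le_of_ne hc.1 ?_, lt_of_le_of_ne hc.2 ?_, hc0⟩
  · rintro rfl
    simp [hc0] at hP
  · rintro rfl
    simp [hc0] at hP

/-- Stengle's Positivstellensatz for two inequalities. -/
theorem exists_neg_one_eq_of_forall_not_nonneg {n : ℕ} (f g : MvPolynomial (Fin n) ℝ)
    (hfg : ∀ x, 0 ≤ MvPolynomial.eval x f → ¬ 0 ≤ MvPolynomial.eval x g) :
    ∃ σ₀ σ₁ σ₂ σ₃, IsSumSq σ₀ ∧ IsSumSq σ₁ ∧ IsSumSq σ₂ ∧ IsSumSq σ₃ ∧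
      -1 = (σ₀ + f * σ₁) + g * (σ₂ + f * σ₃) := by
  by_cases h : IsSumSq (-1 : QuadraticAlgebra (QuadraticAlgebra (MvPolynomial (Fin n) ℝ) f 0)
      (algebraMap _ _ g) 0)
  · obtain ⟨σ, τ, hσ, hτ, h₁⟩ := h.exists_re_eq
    obtain ⟨σ₀, σ₁, hσ₀, hσ₁, h₂⟩ := hσ.exists_re_eq
    obtain ⟨σ₂, σ₃, hσ₂, hσ₃, h₃⟩ := hτ.exists_re_eq
    refine ⟨σ₀, σ₁, σ₂, σ₃, hσ₀, hσ₁, hσ₂, hσ₃, ?_⟩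
    rw [← h₂, ← h₃]
    have h₄ := congrArg QuadraticAlgebra.re h₁
    rw [QuadraticAlgebra.re_add, ← Algebra.smul_def, QuadraticAlgebra.re_smul] at h₄
    exact h₄
  · exfalso
    obtain ⟨K, _, _, _, F, hK⟩ := exists_ringHom_polynomialIVT h
    let F₁ := F.comp (algebraMap (QuadraticAlgebra (MvPolynomial (Fin n) ℝ) f 0) _)
    let φ : MvPolynomial (Fin n) ℝ →+* K := F₁.comp (algebraMap (MvPolynomial (Fin n) ℝ) _)
    have hf : 0 ≤ φ f := by
      have : φ f = F₁ QuadraticAlgebra.omega * F₁ QuadraticAlgebra.omega := by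
        rw [← map_mul]
        exact congrArg F₁ (by simp [QuadraticAlgebra.ext_iff])
      rw [this]
      exact mul_self_nonneg _
    have hg : 0 ≤ φ g := by
      have : φ g = F QuadraticAlgebra.omega * F QuadraticAlgebra.omega := by
        rw [← map_mul]
        exact congrArg F (by simp [QuadraticAlgebra.ext_iff])
      rw [this]
      exact mul_self_nonneg _
    have hi : StrictMono (φ.comp MvPolynomial.C) := by
      intro a b hab
      rw [← sub_pos, ← map_sub]
      refine lt_of_le_of_ne ?_ ((map_ne_zero _).2 (sub_ne_zero.2 hab.ne')).symm
      rw [← Real.mul_self_sqrt (sub_pos.2 hab).le, map_mul]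
      exact mul_self_nonneg _
    have hφ : ∀ p, p.eval₂ (φ.comp MvPolynomial.C) (fun k => φ (MvPolynomial.X k)) = φ p := by
      intro p
      have := MvPolynomial.eval₂_comp_left φ MvPolynomial.C MvPolynomial.X p
      rw [MvPolynomial.eval₂_eta] at this
      exact this.symm
    obtain ⟨y, hy⟩ := polynomialIVT_real.exists_eval_nonneg hK (φ.comp MvPolynomial.C) hi ![f, g]
      (fun k => φ (MvPolynomial.X k)) (fun k => by
        rw [hφ]
        fin_cases k
        exacts [hf, hg])
    exact hfg y (hy 0) (hy 1)

end Positivstellensatz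

section QuadraticModule

/-- A quadratic module of a commutative ring: a subset containing `1`, closed under addition and
under multiplication by squares. -/
structure IsQuadraticModule {A : Type*} [CommRing A] (M : Set A) : Prop where
  one_mem : 1 ∈ M
  add_mem : ∀ {a b}, a ∈ M → b ∈ M → a + b ∈ M
  mul_self_mul_mem : ∀ a {b}, b ∈ M → a * a * b ∈ M

namespace IsQuadraticModule

theorem zero_mem {A : Type*} [CommRing A] {M : Set A} (hM : IsQuadraticModule M) : 0 ∈ M := by
  simpa using hM.mul_self_mul_mem 0 hM.one_mem

theorem isSumSq_mul_mem {A : Type*} [CommRing A] {M : Set A} (hM : IsQuadraticModule M) {σ a : A}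
    (hσ : IsSumSq σ) (ha : a ∈ M) : σ * a ∈ M := by
  induction hσ with
  | zero => simpa using hM.zero_mem
  | sq_add x _ ih =>
    rw [add_mul]
    exact hM.add_mem (hM.mul_self_mul_mem x ha) ih

theorem isSumSq_mem {A : Type*} [CommRing A] {M : Set A} (hM : IsQuadraticModule M) {σ : A}
    (hσ : IsSumSq σ) : σ ∈ M := by
  simpa using hM.isSumSq_mul_mem hσ hM.one_mem

/-- The quadratic module generated by a quadratic module and one more element. -/
theorem adjoin {A : Type*} [CommRing A] {M : Set A} (hM : IsQuadraticModule M) (f : A) :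
    IsQuadraticModule {p | ∃ m ∈ M, ∃ σ, IsSumSq σ ∧ p = m + f * σ} where
  one_mem := ⟨1, hM.one_mem, 0, .zero, by simp⟩
  add_mem := by
    rintro _ _ ⟨m, hm, σ, hσ, rfl⟩ ⟨m', hm', σ', hσ', rfl⟩
    exact ⟨_, hM.add_mem hm hm', _, hσ.add hσ', by ring⟩
  mul_self_mul_mem := by
    rintro a _ ⟨m, hm, σ, hσ, rfl⟩
    exact ⟨_, hM.mul_self_mul_mem a hm, _, (IsSumSq.mul_self a).mul hσ, by ring⟩

variable {A : Type*} [CommRing A] [Algebra ℝ A] {M : Set A}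

theorem algebraMap_mul_mem (hM : IsQuadraticModule M) {c : ℝ} (hc : 0 ≤ c) {a : A} (ha : a ∈ M) :
    algebraMap ℝ A c * a ∈ M := by
  rw [← Real.mul_self_sqrt hc, map_mul]
  exact hM.mul_self_mul_mem _ ha

theorem algebraMap_mem (hM : IsQuadraticModule M) {c : ℝ} (hc : 0 ≤ c) : algebraMap ℝ A c ∈ M := by
  simpa using hM.algebraMap_mul_mem hc hM.one_mem

theorem sq_sub_sq_mem (hM : IsQuadraticModule M) {c : ℝ} (hc : 0 < c) {f : A}
    (h : algebraMap ℝ A c - f ∈ M) (h' : algebraMap ℝ A c + f ∈ M) :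
    algebraMap ℝ A (c * c) - f * f ∈ M := by
  have h₁ := hM.algebraMap_mul_mem (c := (2 * c)⁻¹) (by positivity)
    (hM.add_mem (hM.mul_self_mul_mem (algebraMap ℝ A c - f) h')
      (hM.mul_self_mul_mem (algebraMap ℝ A c + f) h))
  convert h₁ using 1
  have h₂ : algebraMap ℝ A (2 * c)⁻¹ * (2 * algebraMap ℝ A c) = 1 := by
    rw [← map_ofNat (algebraMap ℝ A) 2, ← map_mul, ← map_mul, inv_mul_cancel₀ (by positivity),
      map_one]
  rw [map_mul]
  linear_combination -(algebraMap ℝ A c * algebraMap ℝ A c - f * f) * h₂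

theorem mul_eq_algebraMap_mul (f g : A) :
    f * g = algebraMap ℝ A 4⁻¹ * ((f + g) * (f + g) + -1 * ((f - g) * (f - g))) := by
  have h : algebraMap ℝ A 4⁻¹ * 4 = 1 := by
    rw [← map_ofNat (algebraMap ℝ A) 4, ← map_mul, inv_mul_cancel₀ (by norm_num), map_one]
  linear_combination -f * g * h

/-- A quadratic module containing `N - ∑ Xᵢ²` is archimedean. -/
theorem exists_algebraMap_sub_mem {n : ℕ} {M : Set (MvPolynomial (Fin n) ℝ)}
    (hM : IsQuadraticModule M) {N : ℝ}
    (hN : MvPolynomial.C N - ∑ k, MvPolynomial.X k * MvPolynomial.X k ∈ M)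
    (f : MvPolynomial (Fin n) ℝ) : ∃ c : ℝ, 0 < c ∧ algebraMap ℝ _ c - f ∈ M ∧
      algebraMap ℝ _ c + f ∈ M := by
  have hneg : ∀ f : MvPolynomial (Fin n) ℝ,
      (∃ c : ℝ, 0 < c ∧ algebraMap ℝ _ c - f ∈ M ∧ algebraMap ℝ _ c + f ∈ M) →
      ∃ c : ℝ, 0 < c ∧ algebraMap ℝ _ c - -f ∈ M ∧ algebraMap ℝ _ c + -f ∈ M := by
    rintro f ⟨c, hc, h, h'⟩
    exact ⟨c, hc, by simpa using h', by simpa [← sub_eq_add_neg] using h⟩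
  have hadd : ∀ f g : MvPolynomial (Fin n) ℝ,
      (∃ c : ℝ, 0 < c ∧ algebraMap ℝ _ c - f ∈ M ∧ algebraMap ℝ _ c + f ∈ M) →
      (∃ c : ℝ, 0 < c ∧ algebraMap ℝ _ c - g ∈ M ∧ algebraMap ℝ _ c + g ∈ M) →
      ∃ c : ℝ, 0 < c ∧ algebraMap ℝ _ c - (f + g) ∈ M ∧ algebraMap ℝ _ c + (f + g) ∈ M := by
    rintro f g ⟨c, hc, h, h'⟩ ⟨d, hd, k, k'⟩
    refine ⟨c + d, add_pos hc hd, ?_, ?_⟩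
    · convert hM.add_mem h k using 1
      rw [map_add]
      ring
    · convert hM.add_mem h' k' using 1
      rw [map_add]
      ring
  have hsq : ∀ f : MvPolynomial (Fin n) ℝ,
      (∃ c : ℝ, 0 < c ∧ algebraMap ℝ _ c - f ∈ M ∧ algebraMap ℝ _ c + f ∈ M) →
      ∃ c : ℝ, 0 < c ∧ algebraMap ℝ _ c - f * f ∈ M ∧ algebraMap ℝ _ c + f * f ∈ M := by
    rintro f ⟨c, hc, h, h'⟩
    exact ⟨c * c, mul_pos hc hc, hM.sq_sub_sq_mem hc h h',
      hM.add_mem (hM.algebraMap_mem (mul_pos hc hc).le) (hM.isSumSq_mem (IsSumSq.mul_self f))⟩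
  induction f using MvPolynomial.induction_on with
  | C r =>
    refine ⟨|r| + 1, by positivity, ?_, ?_⟩
    · rw [← MvPolynomial.algebraMap_eq, ← map_sub]
      exact hM.algebraMap_mem (by linarith [le_abs_self r])
    · rw [← MvPolynomial.algebraMap_eq, ← map_add]
      exact hM.algebraMap_mem (by linarith [neg_abs_le r])
  | add f g hf hg => exact hadd f g hf hg
  | mul_X f k hf =>
    have hX : ∃ c : ℝ, 0 < c ∧ algebraMap ℝ _ c - (MvPolynomial.X k : MvPolynomial (Fin n) ℝ) ∈ M ∧
        algebraMap ℝ _ c + (MvPolynomial.X k : MvPolynomial (Fin n) ℝ) ∈ M := by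
      have hrest : MvPolynomial.C (|N| + 1) - MvPolynomial.X k * MvPolynomial.X k ∈ M := by
        have h₁ : (∑ j ∈ Finset.univ.erase k, MvPolynomial.X j * MvPolynomial.X j :
            MvPolynomial (Fin n) ℝ) ∈ M := hM.isSumSq_mem (IsSumSq.sum_mul_self _ _)
        have h₂ : (MvPolynomial.C (|N| + 1 - N) : MvPolynomial (Fin n) ℝ) ∈ M :=
          hM.algebraMap_mem (by linarith [le_abs_self N])
        convert hM.add_mem h₂ (hM.add_mem hN h₁) using 1
        rw [← Finset.add_sum_erase _ _ (Finset.mem_univ k), map_sub]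
        ring
      have hhalf : (2 * MvPolynomial.C 2⁻¹ : MvPolynomial (Fin n) ℝ) = 1 := by
        rw [← map_ofNat MvPolynomial.C 2, ← map_mul, mul_inv_cancel₀ (by norm_num), map_one]
      refine ⟨|N| + 1 + 2⁻¹ * 2⁻¹, by positivity, ?_, ?_⟩
      · convert hM.add_mem hrest (hM.isSumSq_mem (IsSumSq.mul_self
          (MvPolynomial.C 2⁻¹ - MvPolynomial.X k))) using 1
        rw [MvPolynomial.algebraMap_eq, map_add, map_mul]
        linear_combination MvPolynomial.X k * hhalf
      · convert hM.add_mem hrest (hM.isSumSq_mem (IsSumSq.mul_self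
          (MvPolynomial.C 2⁻¹ + MvPolynomial.X k))) using 1
        rw [MvPolynomial.algebraMap_eq, map_add, map_mul]
        linear_combination -MvPolynomial.X k * hhalf
    obtain ⟨c, hc, h, h'⟩ := hadd _ _ (hsq _ (hadd _ _ hf hX))
      (hneg _ (hsq _ (hadd _ _ hf (hneg _ hX))))
    refine ⟨4⁻¹ * c, by positivity, ?_, ?_⟩
    · convert hM.algebraMap_mul_mem (c := 4⁻¹) (by norm_num) h using 1
      rw [mul_eq_algebraMap_mul f, map_mul]
      ring
    · convert hM.algebraMap_mul_mem (c := 4⁻¹) (by norm_num) h' using 1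
      rw [mul_eq_algebraMap_mul f, map_mul]
      ring

end IsQuadraticModule
end QuadraticModule

section Archimedean

/-- A compact set defined by one polynomial inequality makes the corresponding preordering
archimedean. -/
theorem exists_C_sub_sum_sq_eq {n : ℕ} (ρ : MvPolynomial (Fin n) ℝ)
    (hρ : IsCompact {x : Fin n → ℝ | 0 ≤ MvPolynomial.eval x ρ}) :
    ∃ (N : ℝ) (σ τ : MvPolynomial (Fin n) ℝ), IsSumSq σ ∧ IsSumSq τ ∧
      MvPolynomial.C N - ∑ k, MvPolynomial.X k * MvPolynomial.X k = σ + ρ * τ := by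
  set r : MvPolynomial (Fin n) ℝ := ∑ k, MvPolynomial.X k * MvPolynomial.X k
  have hrsq : IsSumSq r := IsSumSq.sum_mul_self _ _
  obtain ⟨N, hN₀, hN⟩ : ∃ N : ℝ, 0 ≤ N ∧ ∀ x, 0 ≤ MvPolynomial.eval x ρ →
      ¬ 0 ≤ MvPolynomial.eval x (r - MvPolynomial.C N) := by
    obtain ⟨B, hB⟩ := hρ.bddAbove_image (f := fun x => MvPolynomial.eval x r)
      (MvPolynomial.continuous_eval r).continuousOn
    refine ⟨|B| + 1, by positivity, fun x hx h => ?_⟩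
    have h₁ : MvPolynomial.eval x r ≤ B := hB ⟨x, hx, rfl⟩
    rw [map_sub, MvPolynomial.eval_C] at h
    linarith [le_abs_self B]
  have hT : IsQuadraticModule {p | ∃ m ∈ {q : MvPolynomial (Fin n) ℝ | IsSumSq q},
      ∃ σ, IsSumSq σ ∧ p = m + ρ * σ} :=
    IsQuadraticModule.adjoin ⟨.one, .add, fun a _ => (IsSumSq.mul_self a).mul⟩ ρ
  set T := {p | ∃ m ∈ {q : MvPolynomial (Fin n) ℝ | IsSumSq q},
      ∃ σ, IsSumSq σ ∧ p = m + ρ * σ}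
  have hmul : ∀ p ∈ T, ∀ q ∈ T, p * q ∈ T := by
    rintro _ ⟨a, ha, b, hb, rfl⟩ _ ⟨c, hc, d, hd, rfl⟩
    exact ⟨_, (ha.mul hc).add ((IsSumSq.mul_self ρ).mul (hb.mul hd)), _,
      (ha.mul hd).add (hb.mul hc), by ring⟩
  obtain ⟨a, b, ha, hb, hab⟩ : ∃ a b, a ∈ T ∧ b ∈ T ∧ 1 + a = (MvPolynomial.C N - r) * b := by
    obtain ⟨σ₀, σ₁, σ₂, σ₃, h₀, h₁, h₂, h₃, h⟩ := exists_neg_one_eq_of_forall_not_nonneg _ _ hN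
    exact ⟨_, _, ⟨σ₀, h₀, σ₁, h₁, rfl⟩, ⟨σ₂, h₂, σ₃, h₃, rfl⟩, by linear_combination -h⟩
  have hT' : IsQuadraticModule {p | ∃ t ∈ T, ∃ t' ∈ T, p = t + (MvPolynomial.C N - r) * t'} := by
    refine ⟨⟨1, hT.one_mem, 0, hT.zero_mem, by ring⟩, ?_, ?_⟩
    · rintro _ _ ⟨t, ht, t', ht', rfl⟩ ⟨u, hu, u', hu', rfl⟩
      exact ⟨_, hT.add_mem ht hu, _, hT.add_mem ht' hu', by ring⟩
    · rintro c _ ⟨t, ht, t', ht', rfl⟩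
      exact ⟨_, hT.mul_self_mul_mem c ht, _, hT.mul_self_mul_mem c ht', by ring⟩
  obtain ⟨N', -, ⟨t, ht, t', ht', h⟩, -⟩ := hT'.exists_algebraMap_sub_mem (N := N)
    ⟨0, hT.zero_mem, 1, hT.one_mem, by ring⟩ a
  rw [MvPolynomial.algebraMap_eq] at h
  have hbound : MvPolynomial.C (N' + N' / 2 * (N' / 2)) - a ∈ T := by
    have h₁ := hT.add_mem (hT.add_mem (hT.add_mem ht (hmul _ ha _ ht))
      (hT.mul_self_mul_mem (MvPolynomial.C N - r) (hmul _ hb _ ht')))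
      (hT.isSumSq_mem (IsSumSq.mul_self (a - MvPolynomial.C (N' / 2))))
    convert h₁ using 1
    have h₂ : (2 * MvPolynomial.C (N' / 2) : MvPolynomial (Fin n) ℝ) = MvPolynomial.C N' := by
      rw [← map_ofNat MvPolynomial.C 2, ← map_mul, mul_div_cancel₀ _ (by norm_num)]
    rw [map_add, map_mul]
    linear_combination (1 + a) * h + (MvPolynomial.C N - r) * t' * hab + a * h₂
  have hfinal := hT.add_mem (hT.add_mem (hT.mul_self_mul_mem (MvPolynomial.C N - r) hb)
    (hT.isSumSq_mul_mem hrsq ha)) (hT.algebraMap_mul_mem hN₀ hbound)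
  obtain ⟨σ, hσ, τ, hτ, h'⟩ := hfinal
  refine ⟨N + N * (N' + N' / 2 * (N' / 2)), σ, τ, hσ, hτ, ?_⟩
  rw [← h', MvPolynomial.algebraMap_eq, map_add, map_mul]
  linear_combination (MvPolynomial.C N - r) * hab

end Archimedean

namespace IsQuadraticModule
variable {A : Type*} [CommRing A] [Algebra ℝ A] {S : Set A}

/-- A quadratic module not containing `-1` is contained in a maximal one. -/
theorem exists_maximal {A : Type*} [CommRing A] {M : Set A} (hM : IsQuadraticModule M)
    (hneg : -1 ∉ M) :
    ∃ S, M ⊆ S ∧ IsQuadraticModule S ∧ -1 ∉ S ∧ ∀ f ∉ S, ∃ s ∈ S, ∃ σ, IsSumSq σ ∧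
      -1 = s + f * σ := by
  obtain ⟨S, hMS, hS⟩ := zorn_subset_nonempty {S : Set A | IsQuadraticModule S ∧ -1 ∉ S} (by
    intro c hc hchain ⟨S₀, hS₀⟩
    refine ⟨⋃₀ c, ⟨⟨⟨S₀, hS₀, (hc hS₀).1.one_mem⟩, ?_, ?_⟩, ?_⟩, fun _ => Set.subset_sUnion_of_mem⟩
    · rintro a b ⟨S, hS, ha⟩ ⟨S', hS', hb⟩
      obtain ⟨S'', hS'', hle, hle'⟩ := hchain.directedOn S hS S' hS'
      exact ⟨S'', hS'', (hc hS'').1.add_mem (hle ha) (hle' hb)⟩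
    · rintro a b ⟨S, hS, hb⟩
      exact ⟨S, hS, (hc hS).1.mul_self_mul_mem a hb⟩
    · rintro ⟨S, hS, h⟩
      exact (hc hS).2 h) M ⟨hM, hneg⟩
  refine ⟨S, hMS, hS.prop.1, hS.prop.2, fun f hf => ?_⟩
  by_contra h
  exact hf (hS.le_of_ge ⟨hS.prop.1.adjoin f, h⟩ (fun s hs => ⟨s, hs, 0, .zero, by simp⟩)
    ⟨0, hS.prop.1.zero_mem, 1, .one, by simp⟩)

theorem mul_mem_of_neg_mem (hS : IsQuadraticModule S) {v : A} (hv : v ∈ S) (hv' : -v ∈ S) (f : A) :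
    f * v ∈ S := by
  have h := hS.algebraMap_mul_mem (c := 4⁻¹) (by norm_num)
    (hS.add_mem (hS.mul_self_mul_mem (f + 1) hv) (hS.mul_self_mul_mem (f - 1) hv'))
  convert h using 1
  linear_combination v * mul_eq_algebraMap_mul f 1

theorem mem_or_neg_mem (hS : IsQuadraticModule S) (hneg : -1 ∉ S)
    (hmax : ∀ f ∉ S, ∃ s ∈ S, ∃ σ, IsSumSq σ ∧ -1 = s + f * σ) (f : A) : f ∈ S ∨ -f ∈ S := by
  by_contra! h
  obtain ⟨s, hs, σ, hσ, h₁⟩ := hmax f h.1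
  obtain ⟨t, ht, τ, hτ, h₂⟩ := hmax (-f) h.2
  have hσ' : -σ ∈ S := by
    convert hS.add_mem (hS.add_mem (hS.isSumSq_mem hτ) (hS.isSumSq_mul_mem hτ hs))
      (hS.isSumSq_mul_mem hσ ht) using 1
    linear_combination τ * h₁ + σ * h₂
  refine hneg ?_
  rw [h₁]
  exact hS.add_mem hs (hS.mul_mem_of_neg_mem (hS.isSumSq_mem hσ) hσ' f)

/-- `f` is congruent to the real number `v` up to infinitesimals with respect to a quadratic
module. -/
def Approx (S : Set A) (f : A) (v : ℝ) : Prop :=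
  ∀ ε : ℝ, 0 < ε → algebraMap ℝ A ε - (f - algebraMap ℝ A v) ∈ S ∧
    algebraMap ℝ A ε + (f - algebraMap ℝ A v) ∈ S

theorem approx_algebraMap (hS : IsQuadraticModule S) (v : ℝ) : Approx S (algebraMap ℝ A v) v := by
  intro ε hε
  simpa using hS.algebraMap_mem hε.le

theorem Approx.add (hS : IsQuadraticModule S) {f g : A} {v w : ℝ} (hf : Approx S f v)
    (hg : Approx S g w) : Approx S (f + g) (v + w) := by
  intro ε hε
  have h : algebraMap ℝ A ε = algebraMap ℝ A (ε / 2) + algebraMap ℝ A (ε / 2) := by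
    rw [← map_add, add_halves]
  obtain ⟨h₁, h₂⟩ := hf (ε / 2) (half_pos hε)
  obtain ⟨h₃, h₄⟩ := hg (ε / 2) (half_pos hε)
  rw [h, map_add]
  constructor
  · convert hS.add_mem h₁ h₃ using 1
    ring
  · convert hS.add_mem h₂ h₄ using 1
    ring

theorem Approx.algebraMap_mul (hS : IsQuadraticModule S) (c : ℝ) {f : A} {v : ℝ}
    (hf : Approx S f v) : Approx S (algebraMap ℝ A c * f) (c * v) := by
  intro ε hε
  rcases eq_or_ne c 0 with rfl | hc
  · simpa using hS.algebraMap_mem hε.le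
  have hc' : 0 < |c| := abs_pos.2 hc
  obtain ⟨h₁, h₂⟩ := hf (ε / |c|) (div_pos hε hc')
  have h₁ := hS.algebraMap_mul_mem hc'.le h₁
  have h₂ := hS.algebraMap_mul_mem hc'.le h₂
  rw [mul_sub, ← map_mul, mul_div_cancel₀ _ hc'.ne'] at h₁
  rw [mul_add, ← map_mul, mul_div_cancel₀ _ hc'.ne'] at h₂
  rw [map_mul]
  rcases abs_choice c with h | h <;> rw [h] at h₁ h₂
  · constructor
    · convert h₁ using 1
      ring
    · convert h₂ using 1
      ring
  · rw [map_neg] at h₁ h₂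
    constructor
    · convert h₂ using 1
      ring
    · convert h₁ using 1
      ring

theorem Approx.mul_self (hS : IsQuadraticModule S) {f : A} {v : ℝ} (hf : Approx S f v) :
    Approx S (f * f) (v * v) := by
  have h₀ : Approx S ((f - algebraMap ℝ A v) * (f - algebraMap ℝ A v)) 0 := by
    intro ε hε
    rw [map_zero, sub_zero]
    obtain ⟨h₁, h₂⟩ := hf (√ε) (Real.sqrt_pos.2 hε)
    have h := hS.sq_sub_sq_mem (Real.sqrt_pos.2 hε) h₁ h₂
    rw [Real.mul_self_sqrt hε.le] at h
    exact ⟨h, hS.add_mem (hS.algebraMap_mem hε.le) (hS.isSumSq_mem (IsSumSq.mul_self _))⟩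
  convert (h₀.add hS (hf.algebraMap_mul hS (2 * v))).add hS
    (hS.approx_algebraMap (-(v * v))) using 1
  · rw [map_mul, map_neg, map_mul, map_ofNat]
    ring
  · ring

theorem Approx.mul (hS : IsQuadraticModule S) {f g : A} {v w : ℝ} (hf : Approx S f v)
    (hg : Approx S g w) : Approx S (f * g) (v * w) := by
  have h₁ := (hf.add hS hg).mul_self hS
  have h₂ := (hf.add hS (hg.algebraMap_mul hS (-1))).mul_self hS
  convert (h₁.add hS (h₂.algebraMap_mul hS (-1))).algebraMap_mul hS 4⁻¹ using 1
  · rw [mul_eq_algebraMap_mul f g, map_neg, map_one]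
    ring
  · ring

theorem exists_approx (hS : IsQuadraticModule S) (hneg : -1 ∉ S)
    (htotal : ∀ f : A, f ∈ S ∨ -f ∈ S) (f : A)
    (hf : ∃ c : ℝ, 0 < c ∧ algebraMap ℝ _ c - f ∈ S ∧ algebraMap ℝ _ c + f ∈ S) :
    ∃ v, Approx S f v := by
  have hconst : ∀ r : ℝ, algebraMap ℝ A r ∈ S → 0 ≤ r := fun r hr => by
    by_contra! h
    refine hneg ?_
    have := hS.algebraMap_mul_mem (c := -r⁻¹) (by simpa using h.le) hr
    rwa [← map_mul, neg_mul, inv_mul_cancel₀ h.ne, map_neg, map_one] at this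
  obtain ⟨c, -, hc, hc'⟩ := hf
  have hbdd : BddAbove {q : ℝ | f - algebraMap ℝ A q ∈ S} := by
    refine ⟨c, fun q hq => ?_⟩
    have := hS.add_mem hc hq
    rw [sub_add_sub_cancel, ← map_sub] at this
    linarith [hconst _ this]
  refine ⟨sSup {q : ℝ | f - algebraMap ℝ A q ∈ S}, fun ε hε => ⟨?_, ?_⟩⟩
  · have h : ¬ f - algebraMap ℝ A (sSup {q : ℝ | f - algebraMap ℝ A q ∈ S} + ε) ∈ S := fun h => by
      linarith [le_csSup hbdd h]
    convert (htotal _).resolve_left h using 1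
    rw [map_add]
    ring
  · obtain ⟨q, hq, hlt⟩ := exists_lt_of_lt_csSup (s := {q : ℝ | f - algebraMap ℝ A q ∈ S})
      ⟨-c, by simpa [add_comm] using hc'⟩ (sub_lt_self _ hε)
    have := hS.add_mem hq (hS.algebraMap_mem (sub_nonneg.2 hlt.le))
    convert this using 1
    simp only [map_sub]
    ring

theorem Approx.nonneg (hS : IsQuadraticModule S) (hneg : -1 ∉ S) {f : A} {v : ℝ}
    (hf : Approx S f v) (hfS : f ∈ S) : 0 ≤ v := by
  by_contra! h
  refine hneg ?_
  have h₁ := hS.algebraMap_mul_mem (c := 2 * (-v)⁻¹) (by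
    have := inv_pos.2 (neg_pos.2 h)
    positivity) (hS.add_mem (hf (-v / 2) (by linarith)).1 hfS)
  convert h₁ using 1
  rw [sub_sub_eq_add_sub, sub_add_cancel, ← map_add, ← map_mul, ← map_one (algebraMap ℝ A),
    ← map_neg]
  congr 1
  have := h.ne
  field_simp
  ring

/-- The archimedean Positivstellensatz: an archimedean quadratic module that does not contain `-1`
is nonnegative at some point. -/
theorem exists_eval_nonneg {n : ℕ} {M : Set (MvPolynomial (Fin n) ℝ)} (hM : IsQuadraticModule M)
    (hneg : -1 ∉ M) {N : ℝ}
    (hN : MvPolynomial.C N - ∑ k, MvPolynomial.X k * MvPolynomial.X k ∈ M) :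
    ∃ x, ∀ m ∈ M, 0 ≤ MvPolynomial.eval x m := by
  obtain ⟨S, hMS, hS, hnegS, hmax⟩ := hM.exists_maximal hneg
  have h := fun k => hS.exists_approx hnegS (hS.mem_or_neg_mem hnegS hmax) (MvPolynomial.X k)
    (hS.exists_algebraMap_sub_mem (hMS hN) _)
  choose x hx using h
  have happrox : ∀ f, Approx S f (MvPolynomial.eval x f) := by
    intro f
    induction f using MvPolynomial.induction_on with
    | C r => simpa using hS.approx_algebraMap (A := MvPolynomial (Fin n) ℝ) r
    | add f g hf hg => simpa using hf.add hS hg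
    | mul_X f k hf => simpa using hf.mul hS (hx k)
  exact ⟨x, fun m hm => (happrox m).nonneg hS hnegS (hMS hm)⟩

end IsQuadraticModule

open MvPolynomial

theorem stmt12 (n s t : ℕ)
    (h : Fin s → MvPolynomial (Fin n) ℝ) (g : Fin t → MvPolynomial (Fin n) ℝ)
    (QM : Set (MvPolynomial (Fin n) ℝ))
    -- `QM = Ideal[h] + Qmod[g]`
    (hQM : QM = {p | ∃ (φ : Fin s → MvPolynomial (Fin n) ℝ)
        (σ0 : MvPolynomial (Fin n) ℝ) (σ : Fin t → MvPolynomial (Fin n) ℝ),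
        IsSumSq σ0 ∧ (∀ j, IsSumSq (σ j)) ∧
        p = (∑ i, h i * φ i) + σ0 + ∑ j, g j * σ j})
    -- archimedean: some `ρ ∈ QM` has compact nonnegativity set
    (harch : ∃ ρ ∈ QM, IsCompact {x : Fin n → ℝ | 0 ≤ eval x ρ})
    -- the basic semialgebraic set is empty
    (hempty : {x : Fin n → ℝ | (∀ i, eval x (h i) = 0) ∧ (∀ j, 0 ≤ eval x (g j))} = ∅) :
    (-1 : MvPolynomial (Fin n) ℝ) ∈ QM := by
  have hM : IsQuadraticModule QM := by
    subst hQM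
    refine ⟨⟨0, 1, 0, .one, fun _ => .zero, by simp⟩, ?_, ?_⟩
    · rintro _ _ ⟨φ, σ₀, σ, hσ₀, hσ, rfl⟩ ⟨φ', σ₀', σ', hσ₀', hσ', rfl⟩
      refine ⟨φ + φ', _, σ + σ', hσ₀.add hσ₀', fun j => (hσ j).add (hσ' j), ?_⟩
      simp only [Pi.add_apply, mul_add, Finset.sum_add_distrib]
      ring
    · rintro a _ ⟨φ, σ₀, σ, hσ₀, hσ, rfl⟩
      refine ⟨fun i => a * a * φ i, _, fun j => a * a * σ j, (IsSumSq.mul_self a).mul hσ₀,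
        fun j => (IsSumSq.mul_self a).mul (hσ j), ?_⟩
      simp only [mul_add, Finset.mul_sum]
      congr 1
      · congr 1
        exact Finset.sum_congr rfl fun i _ => by ring
      · exact Finset.sum_congr rfl fun j _ => by ring
  have hideal : ∀ i c, h i * c ∈ QM := fun i c => by
    rw [hQM]
    exact ⟨Pi.single i c, 0, 0, .zero, fun _ => .zero, by simp [Pi.single_apply]⟩
  have hgen : ∀ j, g j ∈ QM := fun j => by
    rw [hQM]
    refine ⟨0, 0, Pi.single j 1, .zero, fun k => ?_, by simp [Pi.single_apply]⟩
    by_cases hk : k = j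
    · subst hk
      simp
    · simp [hk]
  obtain ⟨ρ, hρ, hcompact⟩ := harch
  obtain ⟨N, σ, τ, hσ, hτ, hN⟩ := exists_C_sub_sum_sq_eq ρ hcompact
  by_contra hneg
  obtain ⟨x, hx⟩ := hM.exists_eval_nonneg hneg (N := N) (by
    rw [hN, mul_comm]
    exact hM.add_mem (hM.isSumSq_mem hσ) (hM.isSumSq_mul_mem hτ hρ))
  refine Set.eq_empty_iff_forall_notMem.1 hempty x ⟨fun i => ?_, fun j => hx _ (hgen j)⟩
  have h₁ := hx _ (hideal i 1)
  have h₂ := hx _ (hideal i (-1))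
  simp only [mul_one, mul_neg, map_neg] at h₁ h₂
  linarith
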